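/- arXiv:1608.04750 — 2 statements merged into one kernel-verified Lean document; each statement's English description precedes it below -/
import Mathlib

section
/- Fix a constant d₀ and for each d with d_S = d − d₀ odd let U_d be the bipartite unitary on ℂ^d⊗ℂ^d defined by U_d|a⟩|b⟩ = U_S|a⟩|b⟩ if a,b < d_S and U_d|a⟩|b⟩ = |a⟩|b⟩ otherwise. Then (i) lim_{d→∞}(I₃(A;C;D)_{U_d} + 2 log₂ d) = 0; (ii) the residual channels N_{A→C,d}(σ_A) = tr_D[U_d(σ_A ⊗ τ_B)U_d†] satisfy lim_{d→∞} ‖N_{A→C,d} − Δ_{A→C}‖_⋄ = 2, where Δ_{A→C} is the completely depolarizing channel σ ↦ τ_C; and (iii) N_{A→C,d} acts as the identity channel on the d₀-dimensional subspace spanned by {|a⟩ : a ≥ d_S}, so its one-shot zero-error quantum capacity is at least log₂ d₀ > 0. -/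
open Matrix Kronecker Filter
open scoped BigOperators Classical ComplexOrder

noncomputable section

namespace Scrambling

/-- The maximally mixed state on a finite-dimensional system `X`. -/
def mmState (X : Type*) [Fintype X] [DecidableEq X] : Matrix X X ℂ :=
  (Fintype.card X : ℂ)⁻¹ • 1

/-- A (possibly rectangular) matrix is unitary if `U Uᴴ = 1` and `Uᴴ U = 1`. -/
def IsUnitaryMat {m n : Type*} [Fintype m] [Fintype n] [DecidableEq m] [DecidableEq n]
    (U : Matrix m n ℂ) : Prop :=
  U * Uᴴ = 1 ∧ Uᴴ * U = 1

/-- Reduced density matrix of a pure state `ψ` on `X ⊗ Y`, tracing out `Y`. -/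
def redDM {X Y : Type*} [Fintype Y] (ψ : X × Y → ℂ) : Matrix X X ℂ :=
  Matrix.of fun x x' => ∑ y, ψ (x, y) * star (ψ (x', y))

/-- Base-2 von Neumann entropy of a (Hermitian) matrix: `S(ρ) = -tr (ρ log₂ ρ)`,
computed via the eigenvalues. Junk value `0` for non-Hermitian matrices. -/
def vNE {n : Type*} [Fintype n] [DecidableEq n] (ρ : Matrix n n ℂ) : ℝ :=
  if h : ρ.IsHermitian then (∑ i, Real.negMulLog (h.eigenvalues i)) / Real.log 2 else 0

/-- Trace norm `‖X‖₁ = tr √(XᴴX)`, via the eigenvalues of `XᴴX`. -/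
def traceNorm {n : Type*} [Fintype n] [DecidableEq n] (X : Matrix n n ℂ) : ℝ :=
  ∑ i, Real.sqrt ((Matrix.posSemidef_conjTranspose_mul_self X).1.eigenvalues i)

/-- Density matrix: positive semidefinite with unit trace. -/
def IsDensityMatrix {n : Type*} [Fintype n] (ρ : Matrix n n ℂ) : Prop :=
  ρ.PosSemidef ∧ ρ.trace = 1

/-- The pure density matrix `|ψ⟩⟨ψ|` associated to a state vector. -/
def pureDM {T : Type*} (ψ : T → ℂ) : Matrix T T ℂ :=
  Matrix.of fun x y => ψ x * star (ψ y)

/-- Extension `id_R ⊗ Φ` of a (linear) map `Φ` on matrices to a reference system `R`. -/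
def extendCh {R A C : Type*} (Φ : Matrix A A ℂ → Matrix C C ℂ)
    (ρ : Matrix (R × A) (R × A) ℂ) : Matrix (R × C) (R × C) ℂ :=
  Matrix.of fun p q => Φ (Matrix.of fun x y => ρ (p.1, x) (q.1, y)) p.2 q.2

/-- Diamond-norm distance between two (linear) maps on matrices:
the supremum over all finite-dimensional reference systems `R = Fin n` and all density
matrices `ρ` on `R ⊗ A` of the trace norm of the difference of the extended outputs. -/
def diamondDist {A C : Type*} [Fintype A] [DecidableEq A] [Fintype C] [DecidableEq C]
    (Φ Ψ : Matrix A A ℂ → Matrix C C ℂ) : ℝ :=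
  sSup {x | ∃ (n : ℕ) (ρ : Matrix (Fin n × A) (Fin n × A) ℂ),
    IsDensityMatrix ρ ∧ x = traceNorm (extendCh Φ ρ - extendCh Ψ ρ)}

/-- The unitary quantum channel `σ ↦ U σ Uᴴ`. -/
def uChannel {m n : Type*} [Fintype m] [Fintype n] (U : Matrix m n ℂ) : Matrix n n ℂ → Matrix m m ℂ :=
  fun σ => U * σ * Uᴴ

/-- The completely depolarizing channel `σ ↦ tr(σ) · τ_C`. -/
def depol (A C : Type*) [Fintype A] [Fintype C] [DecidableEq C] :
    Matrix A A ℂ → Matrix C C ℂ :=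
  fun σ => σ.trace • mmState C

section FourParty

variable {A B C D : Type*} [Fintype A] [Fintype B] [Fintype C] [Fintype D]
  [DecidableEq A] [DecidableEq B] [DecidableEq C] [DecidableEq D]

/-- State vector of the Choi state of a bipartite unitary `U : AB → CD`:
`|U⟩ = (1 ⊗ U)(|Φ⁺⟩_{AA'} ⊗ |Φ⁺⟩_{BB'})`. -/
def choiVec (U : Matrix (C × D) (A × B) ℂ) : (A × B) × C × D → ℂ :=
  fun p => (Real.sqrt (Fintype.card A * Fintype.card B) : ℂ)⁻¹ * U p.2 p.1

/-- Density matrix of the Choi state of a bipartite unitary. -/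
def choiDM (U : Matrix (C × D) (A × B) ℂ) :
    Matrix ((A × B) × C × D) ((A × B) × C × D) ℂ :=
  pureDM (choiVec U)

variable (ψ : (A × B) × C × D → ℂ)

/-- Reduced density matrices of a four-party pure state on `A ⊗ B ⊗ C ⊗ D`. -/
def rhoA : Matrix A A ℂ :=
  redDM fun p : A × (B × C × D) => ψ ((p.1, p.2.1), (p.2.2.1, p.2.2.2))

def rhoB : Matrix B B ℂ :=
  redDM fun p : B × (A × C × D) => ψ ((p.2.1, p.1), (p.2.2.1, p.2.2.2))

def rhoC : Matrix C C ℂ :=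
  redDM fun p : C × (A × B × D) => ψ ((p.2.1, p.2.2.1), (p.1, p.2.2.2))

def rhoD : Matrix D D ℂ :=
  redDM fun p : D × (A × B × C) => ψ ((p.2.1, p.2.2.1), (p.2.2.2, p.1))

def rhoAB : Matrix (A × B) (A × B) ℂ := redDM ψ

def rhoAC : Matrix (A × C) (A × C) ℂ :=
  redDM fun p : (A × C) × B × D => ψ ((p.1.1, p.2.1), (p.1.2, p.2.2))

def rhoAD : Matrix (A × D) (A × D) ℂ :=
  redDM fun p : (A × D) × B × C => ψ ((p.1.1, p.2.1), (p.2.2, p.1.2))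

def rhoBC : Matrix (B × C) (B × C) ℂ :=
  redDM fun p : (B × C) × A × D => ψ ((p.2.1, p.1.1), (p.1.2, p.2.2))

def rhoBD : Matrix (B × D) (B × D) ℂ :=
  redDM fun p : (B × D) × A × C => ψ ((p.2.1, p.1.1), (p.2.2, p.1.2))

def rhoCD : Matrix (C × D) (C × D) ℂ :=
  redDM fun p : (C × D) × A × B => ψ (p.2, p.1)

def rhoABC : Matrix ((A × B) × C) ((A × B) × C) ℂ :=
  redDM fun p : ((A × B) × C) × D => ψ (p.1.1, (p.1.2, p.2))

def rhoABD : Matrix ((A × B) × D) ((A × B) × D) ℂ :=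
  redDM fun p : ((A × B) × D) × C => ψ (p.1.1, (p.2, p.1.2))

def rhoACD : Matrix (A × C × D) (A × C × D) ℂ :=
  redDM fun p : (A × C × D) × B => ψ ((p.1.1, p.2), p.1.2)

def rhoBCD : Matrix (B × C × D) (B × C × D) ℂ :=
  redDM fun p : (B × C × D) × A => ψ ((p.2, p.1.1), p.1.2)

/-- Subsystem von Neumann entropies. -/
def SA : ℝ := vNE (rhoA ψ)
def SB : ℝ := vNE (rhoB ψ)
def SC : ℝ := vNE (rhoC ψ)
def SD : ℝ := vNE (rhoD ψ)
def SAB : ℝ := vNE (rhoAB ψ)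
def SAC : ℝ := vNE (rhoAC ψ)
def SAD : ℝ := vNE (rhoAD ψ)
def SBC : ℝ := vNE (rhoBC ψ)
def SBD : ℝ := vNE (rhoBD ψ)
def SCD : ℝ := vNE (rhoCD ψ)
def SABC : ℝ := vNE (rhoABC ψ)
def SABD : ℝ := vNE (rhoABD ψ)
def SACD : ℝ := vNE (rhoACD ψ)
def SBCD : ℝ := vNE (rhoBCD ψ)

/-- Mutual informations `I(X;Y) = S(X) + S(Y) - S(XY)`. -/
def IAB : ℝ := SA ψ + SB ψ - SAB ψ
def IAC : ℝ := SA ψ + SC ψ - SAC ψ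
def IAD : ℝ := SA ψ + SD ψ - SAD ψ
def IBC : ℝ := SB ψ + SC ψ - SBC ψ
def IBD : ℝ := SB ψ + SD ψ - SBD ψ
def ICD : ℝ := SC ψ + SD ψ - SCD ψ
def IACD : ℝ := SA ψ + SCD ψ - SACD ψ

/-- Tripartite information `I₃(A;C;D) = I(A;C) + I(A;D) - I(A;CD)`. -/
def I3ACD : ℝ := IAC ψ + IAD ψ - IACD ψ

/-- Conditional mutual informations. -/
def cmiAB_C : ℝ := SAC ψ + SBC ψ - SC ψ - SABC ψ
def cmiAB_D : ℝ := SAD ψ + SBD ψ - SD ψ - SABD ψ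
def cmiCD_A : ℝ := SAC ψ + SAD ψ - SA ψ - SACD ψ
def cmiCD_B : ℝ := SBC ψ + SBD ψ - SB ψ - SBCD ψ

/-- Rényi-2 entropy `S₂(ρ) = -log₂ tr ρ²`. -/
def S2 {n : Type*} [Fintype n] (ρ : Matrix n n ℂ) : ℝ :=
  -Real.logb 2 ((ρ * ρ).trace.re)

/-- Rényi-2 tripartite information `I₃⁽²⁾ = S₂(A) + S₂(B) - S₂(AC) - S₂(AD)`. -/
def I3r2 : ℝ := S2 (rhoA ψ) + S2 (rhoB ψ) - S2 (rhoAC ψ) - S2 (rhoAD ψ)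

end FourParty

/-- The residual channel `N_{A→C}(σ) = tr_D [U (σ ⊗ τ_B) Uᴴ]`. -/
def residual {A B C D : Type*} [Fintype A] [Fintype B] [Fintype C] [Fintype D]
    [DecidableEq A] [DecidableEq B]
    (U : Matrix (C × D) (A × B) ℂ) (σ : Matrix A A ℂ) : Matrix C C ℂ :=
  Matrix.of fun c c' => ∑ d, (U * (σ ⊗ₖ mmState B) * Uᴴ) (c, d) (c', d)

/-- A unitary on `X ⊗ X` is a perfect tensor iff all two-party marginals of its
Choi state are maximally mixed. -/
def PerfectTensor {X : Type*} [Fintype X] [DecidableEq X]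
    (U : Matrix (X × X) (X × X) ℂ) : Prop :=
  rhoAB (choiVec U) = mmState (X × X) ∧ rhoAC (choiVec U) = mmState (X × X) ∧
  rhoAD (choiVec U) = mmState (X × X) ∧ rhoBC (choiVec U) = mmState (X × X) ∧
  rhoBD (choiVec U) = mmState (X × X) ∧ rhoCD (choiVec U) = mmState (X × X)

/-- The unitary `U_d` which acts as `U_S` on the subspace spanned by the first `d_S`
basis vectors of each tensor factor, and as the identity otherwise. -/
def embedU (dS d : ℕ) (h : dS ≤ d) (US : Matrix (Fin dS × Fin dS) (Fin dS × Fin dS) ℂ) :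
    Matrix (Fin d × Fin d) (Fin d × Fin d) ℂ :=
  Matrix.of fun o i =>
    if hi : i.1.val < dS ∧ i.2.val < dS then
      if ho : o.1.val < dS ∧ o.2.val < dS then
        US (⟨o.1.val, ho.1⟩, ⟨o.2.val, ho.2⟩) (⟨i.1.val, hi.1⟩, ⟨i.2.val, hi.2⟩)
      else 0
    else if o = i then 1 else 0


section Spectral
variable {n : Type*} [Fintype n] [DecidableEq n]

/-- Conjugation to the eigenbasis of a Hermitian matrix. -/
def conjE {ρ : Matrix n n ℂ} (h : ρ.IsHermitian) (Q : Matrix n n ℂ) : Matrix n n ℂ :=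
  (h.eigenvectorUnitary : Matrix n n ℂ)ᴴ * Q * (h.eigenvectorUnitary : Matrix n n ℂ)

lemma conjE_self {ρ : Matrix n n ℂ} (h : ρ.IsHermitian) :
    conjE h ρ = diagonal (fun i => (h.eigenvalues i : ℂ)) := by
  have := h.conjStarAlgAut_star_eigenvectorUnitary
  rw [Unitary.conjStarAlgAut_star_apply] at this
  exact this

lemma eU_mul {ρ : Matrix n n ℂ} (h : ρ.IsHermitian) :
    (h.eigenvectorUnitary : Matrix n n ℂ) * (h.eigenvectorUnitary : Matrix n n ℂ)ᴴ = 1 :=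
  Unitary.coe_mul_star_self _

lemma eU_mul' {ρ : Matrix n n ℂ} (h : ρ.IsHermitian) :
    (h.eigenvectorUnitary : Matrix n n ℂ)ᴴ * (h.eigenvectorUnitary : Matrix n n ℂ) = 1 :=
  Unitary.coe_star_mul_self _

lemma conjE_trace {ρ : Matrix n n ℂ} (h : ρ.IsHermitian) (Q : Matrix n n ℂ) :
    (conjE h Q).trace = Q.trace := by
  rw [conjE, Matrix.trace_mul_comm, ← Matrix.mul_assoc, eU_mul, Matrix.one_mul]

lemma conjE_mul {ρ : Matrix n n ℂ} (h : ρ.IsHermitian) (P Q : Matrix n n ℂ) :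
    conjE h (P * Q) = conjE h P * conjE h Q := by
  have := eU_mul h
  simp only [conjE]
  calc _ = (h.eigenvectorUnitary : Matrix n n ℂ)ᴴ * P * 1 * Q *
        (h.eigenvectorUnitary : Matrix n n ℂ) := by simp only [Matrix.mul_assoc, Matrix.one_mul]
    _ = _ := by rw [← this]; simp only [Matrix.mul_assoc]

lemma conjE_sub {ρ : Matrix n n ℂ} (h : ρ.IsHermitian) (P Q : Matrix n n ℂ) :
    conjE h (P - Q) = conjE h P - conjE h Q := by
  simp only [conjE, Matrix.mul_sub, Matrix.sub_mul]

lemma conjE_smul {ρ : Matrix n n ℂ} (h : ρ.IsHermitian) (c : ℂ) (Q : Matrix n n ℂ) :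
    conjE h (c • Q) = c • conjE h Q := by
  simp [conjE]

lemma conjE_one {ρ : Matrix n n ℂ} (h : ρ.IsHermitian) :
    conjE h 1 = 1 := by
  rw [conjE, Matrix.mul_one, eU_mul']

lemma conjE_nonneg {ρ : Matrix n n ℂ} (h : ρ.IsHermitian) {Q : Matrix n n ℂ}
    (hQ : Q.PosSemidef) (i : n) : 0 ≤ ((conjE h Q) i i).re := by
  have := (hQ.conjTranspose_mul_mul_same (h.eigenvectorUnitary : Matrix n n ℂ)).diag_nonneg (i := i)
  exact (Complex.le_def.1 this).1

lemma conjE_re_sum {ρ : Matrix n n ℂ} (h : ρ.IsHermitian) (Q : Matrix n n ℂ) :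
    ∑ i, ((conjE h Q) i i).re = Q.trace.re := by
  rw [← conjE_trace h Q, Matrix.trace, Complex.re_sum]; rfl

lemma eig_sum {ρ : Matrix n n ℂ} (h : ρ.IsHermitian) :
    ∑ i, h.eigenvalues i = ρ.trace.re := by
  rw [← conjE_re_sum h, conjE_self]
  simp

lemma vNE_of_sq {ρ : Matrix n n ℂ} (h : ρ.IsHermitian) (N : ℝ) (hN : 0 < N)
    (hsq : ρ * ρ = ((N⁻¹ : ℝ) : ℂ) • ρ) (ht : ρ.trace = 1) : vNE ρ = Real.logb 2 N := by
  have key : ∀ i, h.eigenvalues i * h.eigenvalues i = N⁻¹ * h.eigenvalues i := by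
    intro i
    have h1 : (conjE h (ρ * ρ)) i i = (conjE h (((N⁻¹ : ℝ) : ℂ) • ρ)) i i := by rw [hsq]
    rw [conjE_mul, conjE_smul, conjE_self, Matrix.diagonal_mul_diagonal] at h1
    simp only [Matrix.diagonal_apply_eq, Matrix.smul_apply, smul_eq_mul] at h1
    exact_mod_cast h1
  have h2 : ∀ i, Real.negMulLog (h.eigenvalues i) = h.eigenvalues i * Real.log N := by
    intro i
    by_cases h0 : h.eigenvalues i = 0
    · simp [h0]
    · have : h.eigenvalues i = N⁻¹ := mul_right_cancel₀ h0 (key i)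
      rw [this, Real.negMulLog, Real.log_inv]; ring
  rw [vNE, dif_pos h, Finset.sum_congr rfl fun i _ => h2 i, ← Finset.sum_mul, eig_sum, ht]
  simp [Real.logb]

lemma vNE_le {ρ : Matrix n n ℂ} (h : ρ.PosSemidef) (N : ℝ) (hN : 0 < N)
    (hc : (Fintype.card n : ℝ) = N) (ht : ρ.trace = 1) : vNE ρ ≤ Real.logb 2 N := by
  have key : ∀ i, Real.negMulLog (h.1.eigenvalues i) ≤
      h.1.eigenvalues i * Real.log N + N⁻¹ - h.1.eigenvalues i := by
    intro i
    have h0 := h.eigenvalues_nonneg i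
    rcases h0.eq_or_lt with h0 | h0
    · rw [← h0]; simp; positivity
    · set x := h.1.eigenvalues i
      have := Real.log_le_sub_one_of_pos (x := (x * N)⁻¹) (by positivity)
      rw [Real.log_inv, Real.log_mul h0.ne' hN.ne'] at this
      have h3 := mul_le_mul_of_nonneg_left this h0.le
      have h4 : x * ((x * N)⁻¹ - 1) = N⁻¹ - x := by field_simp
      rw [h4] at h3
      rw [Real.negMulLog]; linarith
  rw [vNE, dif_pos h.1, Real.logb]
  gcongr
  calc _ ≤ _ := Finset.sum_le_sum fun i _ => key i
    _ = _ := by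
      rw [Finset.sum_sub_distrib, Finset.sum_add_distrib, ← Finset.sum_mul, eig_sum, ht]
      simp [hc]
      field_simp
      simp

lemma le_vNE {ρ Q : Matrix n n ℂ} (h : ρ.PosSemidef) (N : ℝ) (hN : 0 < N)
    (ht : ρ.trace = 1) (hQ : Q.PosSemidef) (hQ1 : (1 - Q).PosSemidef)
    (hρQ : (ρ - ((N⁻¹ : ℝ) : ℂ) • Q).PosSemidef) :
    ((Q.trace.re / N) * Real.log N - (1 - Q.trace.re / N)) / Real.log 2 ≤ vNE ρ := by
  set q : n → ℝ := fun i => ((conjE h.1 Q) i i).re with hq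
  have hq0 : ∀ i, 0 ≤ q i := fun i => conjE_nonneg h.1 hQ i
  have hq1 : ∀ i, q i ≤ 1 := fun i => by
    have := conjE_nonneg h.1 hQ1 i
    rw [conjE_sub, conjE_one] at this
    simp at this
    exact this
  have hql : ∀ i, N⁻¹ * q i ≤ h.1.eigenvalues i := fun i => by
    have := conjE_nonneg h.1 hρQ i
    rw [conjE_sub, conjE_smul, conjE_self] at this
    simp [-Complex.ofReal_inv] at this
    exact this
  have hqs : ∑ i, q i = Q.trace.re := conjE_re_sum h.1 Q
  have hls : ∑ i, h.1.eigenvalues i = 1 := by rw [eig_sum, ht]; rfl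
  have hl1 : ∀ i, h.1.eigenvalues i ≤ 1 := fun i => by
    rw [← hls]
    exact Finset.single_le_sum (fun j _ => h.eigenvalues_nonneg j) (Finset.mem_univ i)
  have key : ∀ i, N⁻¹ * q i * Real.log N + N⁻¹ * q i - h.1.eigenvalues i ≤
      Real.negMulLog (h.1.eigenvalues i) := by
    intro i
    have h0 := h.eigenvalues_nonneg i
    have a := hq0 i
    have b := hq1 i
    have c := hql i
    have e := hl1 i
    generalize h.1.eigenvalues i = x at *
    generalize q i = y at *
    rcases h0.eq_or_lt with h0 | h0
    · subst h0
      have : N⁻¹ * y = 0 := le_antisymm c (by positivity)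
      simp [this]
    · have := Real.log_le_sub_one_of_pos (x := x * N) (by positivity)
      rw [Real.log_mul h0.ne' hN.ne'] at this
      have hlog : Real.log x ≤ 0 := Real.log_nonpos h0.le e
      have h1 : N⁻¹ * y * (-Real.log x) ≤ x * (-Real.log x) :=
        mul_le_mul_of_nonneg_right c (by linarith)
      have h2 : N⁻¹ * y * (Real.log N + 1 - x * N) ≤ N⁻¹ * y * (-Real.log x) :=
        mul_le_mul_of_nonneg_left (by linarith) (by positivity)
      have h3 : N⁻¹ * y * (x * N) = y * x := by field_simp
      have h4 : y * x ≤ x := by nlinarith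
      rw [Real.negMulLog]
      nlinarith
  rw [vNE, dif_pos h.1]
  have hl2 : 0 < Real.log 2 := Real.log_pos (by norm_num)
  gcongr
  calc _ = ∑ i, (N⁻¹ * q i * Real.log N + N⁻¹ * q i - h.1.eigenvalues i) := by
        rw [Finset.sum_sub_distrib, Finset.sum_add_distrib, ← Finset.sum_mul, ← Finset.mul_sum, hqs,
          hls]
        ring
    _ ≤ _ := Finset.sum_le_sum fun i _ => key i

lemma eig_sum_eq {M : Matrix n n ℂ} (h : M.IsHermitian) (μ : n → ℝ)
    (hc : M.charpoly = ∏ i, (Polynomial.X - Polynomial.C (μ i : ℂ))) (f : ℝ → ℝ) :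
    ∑ i, f (h.eigenvalues i) = ∑ i, f (μ i) := by
  have h1 := h.roots_charpoly_eq_eigenvalues
  rw [hc, Polynomial.roots_prod _ _ (by
    simp [Finset.prod_ne_zero_iff, Polynomial.X_sub_C_ne_zero])] at h1
  simp at h1
  have h2 := congrArg (fun s => (s.map (fun z : ℂ => f z.re)).sum) h1
  simp [Multiset.map_map] at h2
  exact h2.symm

lemma traceNorm_diagonal (μ : n → ℝ) :
    traceNorm (diagonal fun i => (μ i : ℂ)) = ∑ i, |μ i| := by
  rw [traceNorm, eig_sum_eq _ (fun i => μ i * μ i)]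
  · simp [Real.sqrt_mul_self_eq_abs]
  · rw [Matrix.diagonal_conjTranspose, Matrix.diagonal_mul_diagonal, Matrix.charpoly_diagonal]
    simp

lemma traceNorm_hermitian {X : Matrix n n ℂ} (h : X.IsHermitian) :
    traceNorm X = ∑ i, |h.eigenvalues i| := by
  rw [traceNorm, eig_sum_eq _ (fun i => h.eigenvalues i * h.eigenvalues i)]
  · simp [Real.sqrt_mul_self_eq_abs]
  · rw [h.eq]
    have : (X * X).charpoly = (conjE h (X * X)).charpoly := by
      rw [conjE, Matrix.charpoly_mul_comm _ (h.eigenvectorUnitary : Matrix n n ℂ), ← Matrix.mul_assoc,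
        eU_mul, Matrix.one_mul]
    rw [this, conjE_mul, conjE_self, Matrix.diagonal_mul_diagonal, Matrix.charpoly_diagonal]
    simp

lemma traceNorm_sub_le {P Q : Matrix n n ℂ} (hP : P.PosSemidef) (hQ : Q.PosSemidef) :
    traceNorm (P - Q) ≤ P.trace.re + Q.trace.re := by
  have h : (P - Q).IsHermitian := hP.1.sub hQ.1
  rw [traceNorm_hermitian h, ← conjE_re_sum h P, ← conjE_re_sum h Q, ← Finset.sum_add_distrib]
  refine Finset.sum_le_sum fun i _ => ?_
  have h1 : h.eigenvalues i = ((conjE h P) i i).re - ((conjE h Q) i i).re := by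
    have : (conjE h (P - Q)) i i = (h.eigenvalues i : ℂ) := by rw [conjE_self]; simp
    rw [conjE_sub] at this
    have := congrArg Complex.re this
    simpa using this.symm
  have a := conjE_nonneg h hP i
  have b := conjE_nonneg h hQ i
  rw [h1, abs_le]
  constructor <;> linarith

end Spectral
section Channels

lemma residual_kraus {A B C D : Type*} [Fintype A] [Fintype B] [Fintype C] [Fintype D]
    [DecidableEq A] [DecidableEq B] (U : Matrix (C × D) (A × B) ℂ) (σ : Matrix A A ℂ) :
    residual U σ = ∑ k : D × B,
      (Matrix.of fun (c : C) (a : A) => ((Real.sqrt (Fintype.card B))⁻¹ : ℂ) * U (c, k.1) (a, k.2)) * σ *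
      (Matrix.of fun (c : C) (a : A) =>
        ((Real.sqrt (Fintype.card B))⁻¹ : ℂ) * U (c, k.1) (a, k.2))ᴴ := by
  have hs : ((Real.sqrt (Fintype.card B))⁻¹ : ℂ) * ((Real.sqrt (Fintype.card B))⁻¹ : ℂ)
      = (Fintype.card B : ℂ)⁻¹ := by
    rw [← mul_inv, ← Complex.ofReal_mul, Real.mul_self_sqrt (by positivity)]; simp
  ext c c'
  simp only [residual, Matrix.of_apply, Matrix.sum_apply, Fintype.sum_prod_type]
  refine Finset.sum_congr rfl fun x _ => ?_
  simp only [Matrix.mul_apply, Fintype.sum_prod_type, Matrix.kroneckerMap_apply, mmState,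
    Matrix.smul_apply, Matrix.one_apply, smul_eq_mul, mul_ite, mul_one, mul_zero, Matrix.of_apply,
    Matrix.conjTranspose_apply, Finset.sum_ite_eq', Finset.sum_ite_eq, Finset.mem_univ, if_true]
  rw [Finset.sum_comm]
  refine Finset.sum_congr rfl fun b _ => ?_
  refine Finset.sum_congr rfl fun a _ => ?_
  rw [Finset.sum_mul, Finset.sum_mul]
  refine Finset.sum_congr rfl fun a' _ => ?_
  rw [← hs]
  simp only [star_mul', star_inv₀, Complex.star_def, Complex.conj_ofReal]
  ring

lemma depol_kraus {A C : Type*} [Fintype A] [Fintype C] [DecidableEq A] [DecidableEq C]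
    (σ : Matrix A A ℂ) :
    depol A C σ = ∑ k : C × A,
      (Matrix.of fun (c : C) (a : A) =>
        if c = k.1 then if a = k.2 then ((Real.sqrt (Fintype.card C))⁻¹ : ℂ) else 0 else 0) * σ *
      (Matrix.of fun (c : C) (a : A) =>
        if c = k.1 then if a = k.2 then ((Real.sqrt (Fintype.card C))⁻¹ : ℂ) else 0 else 0)ᴴ := by
  have hs : ((Real.sqrt (Fintype.card C))⁻¹ : ℂ) * ((Real.sqrt (Fintype.card C))⁻¹ : ℂ)
      = (Fintype.card C : ℂ)⁻¹ := by
    rw [← mul_inv, ← Complex.ofReal_mul, Real.mul_self_sqrt (by positivity)]; simp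
  ext c c'
  simp only [depol, Matrix.of_apply, Matrix.sum_apply, Fintype.sum_prod_type, mmState,
    Matrix.smul_apply, Matrix.one_apply, smul_eq_mul, Matrix.mul_apply,
    Matrix.conjTranspose_apply]
  by_cases h : c = c'
  · subst h
    rw [Finset.sum_eq_single c]
    · simp [Matrix.trace, Finset.sum_mul, ← hs]
      refine Finset.sum_congr rfl fun a _ => ?_
      rw [Finset.sum_eq_single a]
      · simp
        ring
      · intro b _ hb
        simp [hb]
      · simp
    · intro b _ hb
      simp [hb.symm]
    · simp
  · rw [Finset.sum_eq_zero]
    · simp [h]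
    · intro x _
      by_cases hx : c = x
      · have : c' ≠ x := by rintro rfl; exact h hx
        simp [this]
      · simp [hx]

lemma extendCh_posSemidef {R A C κ : Type*} [Fintype R] [Fintype A] [Fintype C] [Fintype κ]
    [DecidableEq R]
    (Φ : Matrix A A ℂ → Matrix C C ℂ) (K : κ → Matrix C A ℂ)
    (hΦ : ∀ σ, Φ σ = ∑ k, K k * σ * (K k)ᴴ) (ρ : Matrix (R × A) (R × A) ℂ)
    (hρ : ρ.PosSemidef) : (extendCh Φ ρ).PosSemidef := by
  have : extendCh Φ ρ = ∑ k, ((1 : Matrix R R ℂ) ⊗ₖ K k) * ρ * ((1 : Matrix R R ℂ) ⊗ₖ K k)ᴴ := by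
    ext p q
    simp only [extendCh, hΦ, Matrix.of_apply, Matrix.sum_apply]
    refine Finset.sum_congr rfl fun k _ => ?_
    simp only [Matrix.mul_apply, Fintype.sum_prod_type, Matrix.kroneckerMap_apply,
      Matrix.conjTranspose_apply, Matrix.one_apply, Matrix.of_apply]
    rw [Finset.sum_eq_single q.1]
    · refine Finset.sum_congr rfl fun a _ => ?_
      rw [Finset.sum_eq_single p.1]
      · simp
      · intro b _ hb
        simp [hb.symm]
      · simp
    · intro b _ hb
      simp [hb.symm]
    · simp
  rw [this]
  exact posSemidef_sum _ fun k _ => hρ.mul_mul_conjTranspose_same _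

lemma extendCh_trace {R A C : Type*} [Fintype R] [Fintype A] [Fintype C]
    (Φ : Matrix A A ℂ → Matrix C C ℂ) 
    (hΦ : ∀ σ, (Φ σ).trace = σ.trace) (ρ : Matrix (R × A) (R × A) ℂ) :
    (extendCh Φ ρ).trace = ρ.trace := by
  simp only [Matrix.trace, Matrix.diag_apply, extendCh, Matrix.of_apply, Fintype.sum_prod_type]
  refine Finset.sum_congr rfl fun r _ => ?_
  have := hΦ (Matrix.of fun x y => ρ (r, x) (r, y))
  simpa [Matrix.trace] using this

lemma mmState_trace {B : Type*} [Fintype B] [DecidableEq B] [Nonempty B] :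
    (mmState B).trace = 1 := by
  simp [mmState, Matrix.trace_smul]

lemma residual_trace {A B C D : Type*} [Fintype A] [Fintype B] [Fintype C] [Fintype D]
    [DecidableEq A] [DecidableEq B] [Nonempty B] (U : Matrix (C × D) (A × B) ℂ)
    (hU : Uᴴ * U = 1) (σ : Matrix A A ℂ) : (residual U σ).trace = σ.trace := by
  have : (residual U σ).trace = (U * (σ ⊗ₖ mmState B) * Uᴴ).trace := by
    simp only [Matrix.trace, Matrix.diag_apply, residual, Matrix.of_apply, Fintype.sum_prod_type]
  rw [this, Matrix.trace_mul_comm, ← Matrix.mul_assoc, hU, Matrix.one_mul, Matrix.trace_kronecker,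
    mmState_trace, mul_one]

lemma depol_trace {A C : Type*} [Fintype A] [Fintype C] [DecidableEq C] [Nonempty C]
    (σ : Matrix A A ℂ) : (depol A C σ).trace = σ.trace := by
  simp [depol, Matrix.trace_smul, mmState_trace]

lemma diamond_mem_le {A B C D : Type*} [Fintype A] [Fintype B] [Fintype C] [Fintype D]
    [DecidableEq A] [DecidableEq B] [DecidableEq C] [Nonempty B] [Nonempty C]
    (U : Matrix (C × D) (A × B) ℂ)
    (hU : Uᴴ * U = 1) (n : ℕ) (ρ : Matrix (Fin n × A) (Fin n × A) ℂ) (hρ : IsDensityMatrix ρ) :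
    traceNorm (extendCh (residual U) ρ - extendCh (depol A C) ρ) ≤ 2 := by
  refine (traceNorm_sub_le (extendCh_posSemidef _ _ (residual_kraus U) ρ hρ.1)
    (extendCh_posSemidef _ _ depol_kraus ρ hρ.1)).trans ?_
  rw [extendCh_trace _ (residual_trace U hU), extendCh_trace _ depol_trace, hρ.2]
  norm_num

end Channels
section Embed

/-- Inclusion of the small index set. -/
def emb {s d : ℕ} (h : s ≤ d) (x : Fin s × Fin s) : Fin d × Fin d :=
  (Fin.castLE h x.1, Fin.castLE h x.2)

lemma emb_inj {s d : ℕ} (h : s ≤ d) : Function.Injective (emb h) := by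
  rintro ⟨a, b⟩ ⟨a', b'⟩ hh
  simp only [emb, Prod.mk.injEq, Fin.castLE_inj] at hh
  simp [hh.1, hh.2]

lemma sum_emb {s d : ℕ} (h : s ≤ d) (f : Fin d × Fin d → ℂ)
    (hf : ∀ o, ¬ (o.1.val < s ∧ o.2.val < s) → f o = 0) : ∑ o, f o = ∑ x, f (emb h x) := by
  symm
  refine Fintype.sum_of_injective (emb h) (emb_inj h) _ _ ?_ (fun _ => rfl)
  intro o ho
  apply hf
  intro hlt
  exact ho ⟨(⟨o.1, hlt.1⟩, ⟨o.2, hlt.2⟩), rfl⟩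

lemma exists_emb {s d : ℕ} (h : s ≤ d) (o : Fin d × Fin d) (ho : o.1.val < s ∧ o.2.val < s) :
    ∃ x, o = emb h x := ⟨(⟨o.1, ho.1⟩, ⟨o.2, ho.2⟩), rfl⟩

variable {s d : ℕ} (h : s ≤ d) (US : Matrix (Fin s × Fin s) (Fin s × Fin s) ℂ)

lemma embedU_emb (x y : Fin s × Fin s) : embedU s d h US (emb h x) (emb h y) = US x y := by
  simp [embedU, emb]

lemma embedU_out (o i : Fin d × Fin d) (hi : ¬ (i.1.val < s ∧ i.2.val < s)) :
    embedU s d h US o i = if o = i then 1 else 0 := by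
  rw [embedU, Matrix.of_apply, dif_neg hi]

lemma embedU_out' (o i : Fin d × Fin d) (ho : ¬ (o.1.val < s ∧ o.2.val < s)) :
    embedU s d h US o i = if o = i then 1 else 0 := by
  by_cases hi : i.1.val < s ∧ i.2.val < s
  · rw [embedU, Matrix.of_apply, dif_pos hi, dif_neg ho, if_neg]
    rintro rfl; exact ho hi
  · exact embedU_out h US o i hi

lemma embedU_unitary (hU : USᴴ * US = 1) :
    (embedU s d h US)ᴴ * embedU s d h US = 1 := by
  ext i j
  simp only [Matrix.mul_apply, Matrix.conjTranspose_apply]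
  by_cases hi : i.1.val < s ∧ i.2.val < s
  · by_cases hj : j.1.val < s ∧ j.2.val < s
    · obtain ⟨x, rfl⟩ := exists_emb h i hi
      obtain ⟨y, rfl⟩ := exists_emb h j hj
      rw [sum_emb h]
      · simp only [embedU_emb]
        have := congrFun (congrFun hU x) y
        simp only [Matrix.mul_apply, Matrix.conjTranspose_apply] at this
        rw [this]
        simp [Matrix.one_apply, (emb_inj h).eq_iff]
      · intro o ho
        rw [embedU_out' h US o _ ho, if_neg]
        · simp
        · rintro rfl; exact ho hi
    · rw [Finset.sum_eq_single j]
      · rw [embedU_out' h US j _ hj, embedU_out' h US j _ hj]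
        have : i ≠ j := by rintro rfl; exact hj hi
        simp [this, this.symm]
      · intro o _ ho
        rw [embedU_out h US o j hj, if_neg ho, mul_zero]
      · simp
  · rw [Finset.sum_eq_single i]
    · rw [embedU_out' h US i _ hi, embedU_out' h US i _ hi]
      simp [Matrix.one_apply]
    · intro o _ ho
      rw [embedU_out h US o i hi, if_neg ho, star_zero, zero_mul]
    · simp

lemma residual_id (σ : Matrix (Fin d) (Fin d) ℂ)
    (hσ : ∀ x y : Fin d, (x.val < s ∨ y.val < s) → σ x y = 0) :
    residual (embedU s d h US) σ = σ := by
  have h1 : embedU s d h US * (σ ⊗ₖ mmState (Fin d)) = σ ⊗ₖ mmState (Fin d) := by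
    ext o j
    rw [Matrix.mul_apply, Finset.sum_eq_single o]
    · by_cases ho : o.1.val < s
      · simp [Matrix.kroneckerMap_apply, hσ o.1 j.1 (Or.inl ho)]
      · rw [embedU_out h US o o (fun hh => ho hh.1)]; simp
    · intro i _ hi
      by_cases ho : i.1.val < s
      · simp [Matrix.kroneckerMap_apply, hσ i.1 j.1 (Or.inl ho)]
      · rw [embedU_out h US o i (fun hh => ho hh.1), if_neg hi.symm, zero_mul]
    · simp
  have h2 : (σ ⊗ₖ mmState (Fin d)) * (embedU s d h US)ᴴ = σ ⊗ₖ mmState (Fin d) := by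
    ext j o
    rw [Matrix.mul_apply, Finset.sum_eq_single o]
    · by_cases ho : o.1.val < s
      · simp [Matrix.kroneckerMap_apply, hσ j.1 o.1 (Or.inr ho)]
      · rw [Matrix.conjTranspose_apply, embedU_out h US o o (fun hh => ho hh.1)]; simp
    · intro i _ hi
      by_cases ho : i.1.val < s
      · simp [Matrix.kroneckerMap_apply, hσ j.1 i.1 (Or.inr ho)]
      · rw [Matrix.conjTranspose_apply, embedU_out h US o i (fun hh => ho hh.1), if_neg hi.symm,
          star_zero, mul_zero]
    · simp
  ext c c'
  have : NeZero d := ⟨by have := c.2; omega⟩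
  simp only [residual, h1, h2, Matrix.of_apply, Matrix.kroneckerMap_apply, ← Finset.mul_sum]
  have := mmState_trace (B := Fin d)
  rw [Matrix.trace] at this
  simp only [Matrix.diag_apply] at this
  rw [this, mul_one]

lemma diamond_le_two (hd : 0 < d) (hU : USᴴ * US = 1) :
    diamondDist (residual (embedU s d h US)) (depol (Fin d) (Fin d)) ≤ 2 := by
  have : NeZero d := ⟨hd.ne'⟩
  refine Real.sSup_le ?_ (by norm_num)
  rintro x ⟨n, ρ, hρ, rfl⟩
  exact diamond_mem_le _ (embedU_unitary h US hU) n ρ hρ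

lemma le_diamond (hs : s < d) (hU : USᴴ * US = 1) :
    2 - 2 / (d : ℝ) ≤ diamondDist (residual (embedU s d h US)) (depol (Fin d) (Fin d)) := by
  have hd : 0 < d := by omega
  have : NeZero d := ⟨hd.ne'⟩
  have hdR : (0 : ℝ) < d := by exact_mod_cast hd
  set a : Fin d := ⟨s, hs⟩ with ha
  set ρ : Matrix (Fin 1 × Fin d) (Fin 1 × Fin d) ℂ :=
    diagonal (fun p => if p.2 = a then 1 else 0) with hρ
  have hdm : IsDensityMatrix ρ := by
    constructor
    · refine Matrix.PosSemidef.diagonal fun p => ?_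
      by_cases hp : p.2 = a <;> simp [hp]
    · rw [hρ, Matrix.trace_diagonal, Fintype.sum_prod_type]
      simp only [Finset.univ_unique, Finset.sum_singleton, Finset.sum_ite_eq', Finset.mem_univ,
        if_true]
  have hval : extendCh (residual (embedU s d h US)) ρ - extendCh (depol (Fin d) (Fin d)) ρ =
      diagonal (fun p => (((if p.2 = a then 1 else 0) - (d : ℝ)⁻¹ : ℝ) : ℂ)) := by
    ext p q
    have hp : p.1 = q.1 := Subsingleton.elim _ _
    have hσ : (Matrix.of fun x y => ρ (p.1, x) (q.1, y)) = diagonal (fun x => if x = a then 1 else 0) := by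
      ext x y
      simp [hρ, Matrix.diagonal_apply, hp]
    rw [Matrix.sub_apply, extendCh, extendCh, Matrix.of_apply, Matrix.of_apply, hσ, residual_id]
    · by_cases hpq : p.2 = q.2
      · have : p = q := Prod.ext hp hpq
        subst this
        by_cases hpa : p.2 = a <;> simp [depol, mmState, hpa]
      · have : p ≠ q := fun hh => hpq (by rw [hh])
        simp [depol, mmState, hpq, this]
    · intro x y hxy
      by_cases hx : x = y
      · subst hx
        have : x ≠ a := by rintro rfl; simp [ha] at hxy
        simp [this]
      · simp [hx]
  have hle : traceNorm (extendCh (residual (embedU s d h US)) ρ - extendCh (depol (Fin d) (Fin d)) ρ)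
      ≤ diamondDist (residual (embedU s d h US)) (depol (Fin d) (Fin d)) := by
    refine le_csSup ⟨2, ?_⟩ ⟨1, ρ, hdm, rfl⟩
    rintro x ⟨n, ρ, hρ, rfl⟩
    exact diamond_mem_le _ (embedU_unitary h US hU) n ρ hρ
  refine le_trans (le_of_eq ?_) hle
  rw [hval, traceNorm_diagonal, Fintype.sum_prod_type]
  simp only [Finset.univ_unique, Finset.sum_singleton]
  rw [← Finset.add_sum_erase _ _ (Finset.mem_univ a)]
  have h1 : (d : ℝ)⁻¹ ≤ 1 := inv_le_one_of_one_le₀ (by exact_mod_cast hd)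
  have h2 : ∀ x ∈ Finset.univ.erase a, |(if x = a then (1 : ℝ) else 0) - (d : ℝ)⁻¹| = (d : ℝ)⁻¹ := by
    intro x hx
    rw [if_neg (Finset.ne_of_mem_erase hx), zero_sub, abs_neg, abs_of_pos (by positivity)]
  rw [Finset.sum_congr rfl h2, if_pos rfl, abs_of_nonneg (by linarith), Finset.sum_const,
    Finset.card_erase_of_mem (Finset.mem_univ a), Finset.card_univ, Fintype.card_fin, nsmul_eq_mul,
    Nat.cast_sub hd]
  field_simp
  push_cast
  ring

lemma decoder (d₀ : ℕ) (hd₀ : 0 < d₀) (hs : s + d₀ = d) :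
    ∃ V : Matrix (Fin d) (Fin d₀) ℂ, Vᴴ * V = 1 ∧
        ∃ (k : ℕ) (K : Fin k → Matrix (Fin d₀) (Fin d) ℂ),
          (∑ i, (K i)ᴴ * K i) = 1 ∧
          ∀ σ : Matrix (Fin d₀) (Fin d₀) ℂ,
            (∑ i, K i * residual (embedU s d h US) (V * σ * Vᴴ) * (K i)ᴴ) = σ := by
  set V : Matrix (Fin d) (Fin d₀) ℂ := Matrix.of fun x j => if x.val = s + j.val then 1 else 0
    with hV
  have hV1 : Vᴴ * V = 1 := by
    ext i j
    simp only [Matrix.mul_apply, Matrix.conjTranspose_apply, hV, Matrix.of_apply]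
    rw [Finset.sum_eq_single (⟨s + i, by omega⟩ : Fin d)]
    · by_cases hij : i = j
      · subst hij; simp
      · simp [hij, Fin.val_inj]
    · intro b _ hb
      have : b.val ≠ s + i.val := fun hh => hb (Fin.ext hh)
      simp [this]
    · simp
  have hVz : ∀ (x : Fin d) (j : Fin d₀), x.val < s → V x j = 0 := by
    intro x j hx
    simp only [hV, Matrix.of_apply]
    rw [if_neg]; omega
  refine ⟨V, hV1, d + 1, Fin.cons Vᴴ (fun y => Matrix.of fun j x =>
    if x = y ∧ y.val < s ∧ j.val = 0 then 1 else 0), ?_, ?_⟩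
  · rw [Fin.sum_univ_succ]
    simp only [Fin.cons_zero, Fin.cons_succ, Matrix.conjTranspose_conjTranspose]
    ext x y
    simp only [Matrix.add_apply, Matrix.sum_apply, Matrix.mul_apply, Matrix.conjTranspose_apply,
      Matrix.of_apply]
    by_cases hx : x.val < s
    · rw [Finset.sum_eq_zero (fun j _ => by rw [hVz x j hx, zero_mul]), zero_add,
        Finset.sum_eq_single x]
      · rw [Finset.sum_eq_single (⟨0, hd₀⟩ : Fin d₀)]
        · simp [hx, Matrix.one_apply, eq_comm]
        · intro b _ hb
          have : b.val ≠ 0 := fun hh => hb (Fin.ext hh)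
          simp [this]
        · simp
      · intro z _ hz
        simp [hz.symm]
      · simp
    · have h2 : ∀ z : Fin d, ∑ j : Fin d₀, star (if x = z ∧ z.val < s ∧ j.val = 0 then (1 : ℂ) else 0)
          * (if y = z ∧ z.val < s ∧ j.val = 0 then (1 : ℂ) else 0) = 0 := by
        intro z
        refine Finset.sum_eq_zero fun j _ => ?_
        have : ¬ (x = z ∧ z.val < s ∧ j.val = 0) := by
          rintro ⟨rfl, hh, _⟩; exact hx hh
        rw [if_neg this]; simp
      rw [Finset.sum_congr rfl (fun z _ => h2 z), Finset.sum_const_zero, add_zero,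
        Finset.sum_eq_single (⟨x.val - s, by omega⟩ : Fin d₀)]
      · have h3 : x.val = s + (x.val - s) := by omega
        simp only [hV, Matrix.of_apply, Matrix.one_apply]
        rw [if_pos h3]
        by_cases hxy : x = y
        · subst hxy; simp [← h3]
        · have : y.val ≠ s + (x.val - s) := fun hh => hxy (Fin.ext (by omega))
          simp [hxy, this]
      · intro b _ hb
        have : x.val ≠ s + b.val := fun hh => hb (Fin.ext (by simp; omega))
        simp [hV, this]
      · simp
  · intro σ
    have hz : ∀ x y : Fin d, (x.val < s ∨ y.val < s) → (V * σ * Vᴴ) x y = 0 := by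
      intro x y hxy
      rcases hxy with hx | hy
      · rw [Matrix.mul_apply]
        refine Finset.sum_eq_zero fun j _ => ?_
        rw [Matrix.mul_apply, Finset.sum_eq_zero (fun i _ => by rw [hVz x i hx, zero_mul]), zero_mul]
      · rw [Matrix.mul_apply]
        refine Finset.sum_eq_zero fun j _ => ?_
        rw [Matrix.conjTranspose_apply, hVz y j hy, star_zero, mul_zero]
    rw [residual_id h US _ hz, Fin.sum_univ_succ]
    simp only [Fin.cons_zero, Fin.cons_succ, Matrix.conjTranspose_conjTranspose]
    rw [Finset.sum_eq_zero, add_zero]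
    · calc _ = (Vᴴ * V) * σ * (Vᴴ * V) := by simp only [Matrix.mul_assoc]
        _ = σ := by rw [hV1, Matrix.one_mul, Matrix.mul_one]
    · intro y _
      have : (Matrix.of fun (j : Fin d₀) (x : Fin d) =>
          if x = y ∧ y.val < s ∧ j.val = 0 then (1 : ℂ) else 0) * (V * σ * Vᴴ) = 0 := by
        ext j x
        rw [Matrix.mul_apply, Matrix.zero_apply]
        refine Finset.sum_eq_zero fun z _ => ?_
        by_cases hzs : z.val < s
        · rw [hz z x (Or.inl hzs), mul_zero]
        · rw [Matrix.of_apply, if_neg, zero_mul]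
          rintro ⟨rfl, hh, _⟩; exact hzs hh
      rw [this, Matrix.zero_mul]

end Embed
section Entropy

lemma redDM_eq {X Y : Type*} [Fintype Y] (ψ : X × Y → ℂ) :
    redDM ψ = (Matrix.of fun x y => ψ (x, y)) * (Matrix.of fun x y => ψ (x, y))ᴴ := by
  ext x x'
  simp [redDM, Matrix.mul_apply]

lemma redDM_posSemidef {X Y : Type*} [Fintype X] [Fintype Y] (ψ : X × Y → ℂ) :
    (redDM ψ).PosSemidef := by
  rw [redDM_eq]; exact posSemidef_self_mul_conjTranspose _

lemma vNE_mmState {X : Type*} [Fintype X] [DecidableEq X] [Nonempty X] :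
    vNE (mmState X) = Real.logb 2 (Fintype.card X) := by
  have hh : (mmState X).IsHermitian := by
    rw [Matrix.IsHermitian, mmState, Matrix.conjTranspose_smul]; simp
  refine vNE_of_sq hh _ (by exact_mod_cast Fintype.card_pos) ?_ mmState_trace
  simp [mmState]

variable {d : ℕ}

lemma choiVec_apply (U : Matrix (Fin d × Fin d) (Fin d × Fin d) ℂ) (p) :
    choiVec U p = (d : ℂ)⁻¹ * U p.2 p.1 := by
  rw [choiVec]
  simp only [Fintype.card_fin]
  rw [Real.sqrt_mul_self (by positivity)]; simp

lemma star_dinv : star ((d : ℂ)⁻¹) = (d : ℂ)⁻¹ := by simp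

variable (U : Matrix (Fin d × Fin d) (Fin d × Fin d) ℂ)

lemma colU (hU : Uᴴ * U = 1) (i j : Fin d × Fin d) :
    ∑ c, ∑ e, U (c, e) i * star (U (c, e) j) = if i = j then 1 else 0 := by
  have := congrFun (congrFun hU j) i
  simp only [Matrix.mul_apply, Matrix.conjTranspose_apply, Fintype.sum_prod_type,
    Matrix.one_apply] at this
  simp only [eq_comm (a := i), ← this, mul_comm]

lemma rowU (hU : U * Uᴴ = 1) (i j : Fin d × Fin d) :
    ∑ c, ∑ e, U i (c, e) * star (U j (c, e)) = if i = j then 1 else 0 := by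
  have := congrFun (congrFun hU i) j
  simpa only [Matrix.mul_apply, Matrix.conjTranspose_apply, Fintype.sum_prod_type,
    Matrix.one_apply] using this

lemma psi_mul (p q) : choiVec U p * star (choiVec U q) =
    (d : ℂ)⁻¹ * (d : ℂ)⁻¹ * (U p.2 p.1 * star (U q.2 q.1)) := by
  rw [choiVec_apply, choiVec_apply, star_mul', star_dinv]; ring

lemma sum3 (f : Fin d → Fin d → Fin d → ℂ) :
    ∑ x, ∑ y, ∑ e, f x y e = ∑ e, ∑ x, ∑ y, f x y e := by
  rw [Finset.sum_congr rfl (fun x _ => Finset.sum_comm), Finset.sum_comm]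

lemma rhoA_eq (hd : 0 < d) (hU : Uᴴ * U = 1) : rhoA (choiVec U) = mmState (Fin d) := by
  have hdC : (d : ℂ) ≠ 0 := by exact_mod_cast hd.ne'
  ext a a'
  simp only [rhoA, redDM, Matrix.of_apply, psi_mul, ← Finset.mul_sum, Fintype.sum_prod_type,
    colU U hU, mmState, Matrix.smul_apply, Matrix.one_apply, Prod.mk.injEq, and_true,
    Fintype.card_fin, smul_eq_mul]
  by_cases h : a = a' <;> simp [h]
  field_simp

lemma rhoC_eq (hd : 0 < d) (hU : U * Uᴴ = 1) : rhoC (choiVec U) = mmState (Fin d) := by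
  have hdC : (d : ℂ) ≠ 0 := by exact_mod_cast hd.ne'
  ext a a'
  simp only [rhoC, redDM, Matrix.of_apply, psi_mul, ← Finset.mul_sum, Fintype.sum_prod_type]
  rw [sum3 fun x y e => U (a, e) (x, y) * star (U (a', e) (x, y))]
  simp only [rowU U hU, mmState, Matrix.smul_apply, Matrix.one_apply, Prod.mk.injEq, and_true,
    Fintype.card_fin, smul_eq_mul]
  by_cases h : a = a' <;> simp [h]
  field_simp

lemma rhoD_eq (hd : 0 < d) (hU : U * Uᴴ = 1) : rhoD (choiVec U) = mmState (Fin d) := by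
  have hdC : (d : ℂ) ≠ 0 := by exact_mod_cast hd.ne'
  ext a a'
  simp only [rhoD, redDM, Matrix.of_apply, psi_mul, ← Finset.mul_sum, Fintype.sum_prod_type]
  rw [sum3 fun x y e => U (e, a) (x, y) * star (U (e, a') (x, y))]
  simp only [rowU U hU, mmState, Matrix.smul_apply, Matrix.one_apply, Prod.mk.injEq, true_and,
    Fintype.card_fin, smul_eq_mul]
  by_cases h : a = a' <;> simp [h]
  field_simp

lemma rhoCD_eq (hU : U * Uᴴ = 1) : rhoCD (choiVec U) = mmState (Fin d × Fin d) := by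
  ext a a'
  simp only [rhoCD, redDM, Matrix.of_apply, psi_mul, ← Finset.mul_sum, Fintype.sum_prod_type,
    rowU U hU, mmState, Matrix.smul_apply, Matrix.one_apply,
    Fintype.card_prod, Fintype.card_fin, smul_eq_mul]
  simp

lemma norm_sum (hd : 0 < d) (hU : Uᴴ * U = 1) :
    ∑ a, ∑ b, ∑ c, ∑ e, choiVec U ((a, b), (c, e)) * star (choiVec U ((a, b), (c, e))) = 1 := by
  have hdC : (d : ℂ) ≠ 0 := by exact_mod_cast hd.ne'
  simp only [psi_mul, ← Finset.mul_sum, colU U hU]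
  simp
  field_simp

lemma SACD_eq (hd : 0 < d) (hU : Uᴴ * U = 1) : SACD (choiVec U) = Real.logb 2 d := by
  have hdC : (d : ℂ) ≠ 0 := by exact_mod_cast hd.ne'
  have hd0 : (0 : ℝ) < d := by exact_mod_cast hd
  rw [SACD, rhoACD]
  have hM : ∀ M : Matrix (Fin d × Fin d × Fin d) (Fin d) ℂ,
      Mᴴ * M = (((d : ℝ)⁻¹ : ℝ) : ℂ) • 1 →
      (M * Mᴴ) * (M * Mᴴ) = (((d : ℝ)⁻¹ : ℝ) : ℂ) • (M * Mᴴ) := by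
    intro M hM
    calc _ = M * (Mᴴ * M) * Mᴴ := by simp only [Matrix.mul_assoc]
      _ = _ := by rw [hM]; simp
  refine vNE_of_sq (redDM_posSemidef _).1 d hd0 ?_ ?_
  · rw [redDM_eq]
    apply hM
    ext b b'
    simp only [Matrix.mul_apply, Matrix.conjTranspose_apply, Matrix.of_apply, 
      Fintype.sum_prod_type]
    simp only [mul_comm (star (choiVec U _)), psi_mul, ← Finset.mul_sum, colU U hU]
    by_cases h : b = b'
    · subst h; simp; field_simp
    · simp [h, Ne.symm h]
  · rw [← norm_sum U hd hU]
    simp only [redDM, Matrix.trace, Matrix.diag_apply, Matrix.of_apply,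
      Fintype.sum_prod_type]
    refine Finset.sum_congr rfl fun a _ => ?_
    rw [Finset.sum_congr rfl (fun c _ => Finset.sum_comm), Finset.sum_comm]

lemma trace_AC (hd : 0 < d) (hU : Uᴴ * U = 1) : (rhoAC (choiVec U)).trace = 1 := by
  rw [← norm_sum U hd hU]
  simp only [rhoAC, redDM, Matrix.trace, Matrix.diag_apply, Matrix.of_apply,
    Fintype.sum_prod_type]
  exact Finset.sum_congr rfl fun a _ => Finset.sum_comm

lemma trace_AD (hd : 0 < d) (hU : Uᴴ * U = 1) : (rhoAD (choiVec U)).trace = 1 := by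
  rw [← norm_sum U hd hU]
  simp only [rhoAD, redDM, Matrix.trace, Matrix.diag_apply, Matrix.of_apply,
    Fintype.sum_prod_type]
  refine Finset.sum_congr rfl fun a _ => ?_
  rw [Finset.sum_comm]
  exact Finset.sum_congr rfl fun b _ => Finset.sum_comm

lemma I3_eq (hd : 0 < d) (hU : Uᴴ * U = 1) :
    I3ACD (choiVec U) + 2 * Real.logb 2 d =
      (2 * Real.logb 2 d - vNE (rhoAC (choiVec U))) +
      (2 * Real.logb 2 d - vNE (rhoAD (choiVec U))) := by
  have hU' : U * Uᴴ = 1 := mul_eq_one_comm.1 hU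
  have : NeZero d := ⟨hd.ne'⟩
  have hdR : (d : ℝ) ≠ 0 := by exact_mod_cast hd.ne'
  have h2 : SCD (choiVec U) = 2 * Real.logb 2 d := by
    rw [SCD, rhoCD_eq U hU', vNE_mmState]
    simp only [Fintype.card_prod, Fintype.card_fin, Nat.cast_mul]
    rw [Real.logb_mul hdR hdR]; ring
  rw [I3ACD, IAC, IAD, IACD, SACD_eq U hd hU, h2, SA, SC, SD, rhoA_eq U hd hU, rhoC_eq U hd hU',
    rhoD_eq U hd hU', vNE_mmState, SAC, SAD, Fintype.card_fin]
  ring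

lemma key_bound {s : ℕ} (hs : s ≤ d) (hd : 0 < d)
    (ψ : (Fin d × Fin d) × (Fin d × Fin d) → ℂ) (ht : (redDM ψ).trace = 1)
    (W : Matrix (Fin d × Fin d) (Fin s × Fin s) ℂ)
    (hWW : W * Wᴴ = diagonal fun x => if x.1.val < s ∧ x.2.val < s then 1 else 0)
    (hcol : ∀ y, ∑ x, W x y * star (W x y) = 1)
    (h1 : ∀ x, ∀ y : Fin s × Fin s, y.1 ≠ y.2 → ψ (x, emb hs y) = (d : ℂ)⁻¹ * W x y) :
    ((((s : ℝ) ^ 2 - s) / (d : ℝ) ^ 2) * Real.log ((d : ℝ) ^ 2)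
      - (1 - ((s : ℝ) ^ 2 - s) / (d : ℝ) ^ 2)) / Real.log 2 ≤ vNE (redDM ψ) := by
  set Wg : Matrix (Fin d × Fin d) (Fin s × Fin s) ℂ :=
    Matrix.of fun x y => if y.1 ≠ y.2 then W x y else 0 with hWg
  set Wb : Matrix (Fin d × Fin d) (Fin s × Fin s) ℂ :=
    Matrix.of fun x y => if y.1 ≠ y.2 then 0 else W x y with hWb
  have hsum : W * Wᴴ = Wg * Wgᴴ + Wb * Wbᴴ := by
    ext x x'
    simp only [Matrix.mul_apply, Matrix.add_apply, Matrix.conjTranspose_apply,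
      ← Finset.sum_add_distrib]
    refine Finset.sum_congr rfl fun y _ => ?_
    simp only [hWg, hWb, Matrix.of_apply]
    split_ifs <;> simp
  have htr : (Wg * Wgᴴ).trace = (((s : ℝ) ^ 2 - s : ℝ) : ℂ) := by
    simp only [Matrix.trace, Matrix.diag_apply, Matrix.mul_apply, Matrix.conjTranspose_apply]
    rw [Finset.sum_comm]
    have : ∀ y, ∑ x, Wg x y * star (Wg x y) = 1 - if y.1 = y.2 then (1 : ℂ) else 0 := by
      intro y
      by_cases hy : y.1 = y.2
      · simp [hWg, hy]
      · simp only [hWg, Matrix.of_apply]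
        rw [if_neg hy, sub_zero, ← hcol y]
        simp [hy]
    rw [Finset.sum_congr rfl fun y _ => this y, Finset.sum_sub_distrib, Fintype.sum_prod_type (f := 
      fun y : Fin s × Fin s => if y.1 = y.2 then (1 : ℂ) else 0)]
    simp
    ring
  have hQ1 : (1 - Wg * Wgᴴ).PosSemidef := by
    have : 1 - Wg * Wgᴴ = diagonal (fun x : Fin d × Fin d =>
        if x.1.val < s ∧ x.2.val < s then (0 : ℂ) else 1) + Wb * Wbᴴ := by
      have h3 : Wg * Wgᴴ = W * Wᴴ - Wb * Wbᴴ := by rw [hsum]; abel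
      rw [h3, hWW, ← sub_add, ← Matrix.diagonal_one, Matrix.diagonal_sub]
      congr 2
      ext x
      split_ifs <;> simp
    rw [this]
    refine Matrix.PosSemidef.add (Matrix.PosSemidef.diagonal fun x => ?_)
      (posSemidef_self_mul_conjTranspose _)
    simp only [Pi.zero_apply]
    split_ifs <;> simp
  have hρQ : (redDM ψ - (((((d : ℝ) ^ 2)⁻¹ : ℝ)) : ℂ) • (Wg * Wgᴴ)).PosSemidef := by
    have : redDM ψ - (((((d : ℝ) ^ 2)⁻¹ : ℝ)) : ℂ) • (Wg * Wgᴴ) =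
        redDM (fun p : (Fin d × Fin d) × (Fin d × Fin d) =>
          if p.2.1.val < s ∧ p.2.2.val < s ∧ p.2.1 ≠ p.2.2 then 0 else ψ p) := by
      rw [sub_eq_iff_eq_add]
      ext x x'
      have h5 : ((((((d : ℝ) ^ 2)⁻¹ : ℝ)) : ℂ) • (Wg * Wgᴴ)) x x' =
          ∑ y : Fin d × Fin d, if y.1.val < s ∧ y.2.val < s ∧ y.1 ≠ y.2 then
            ψ (x, y) * star (ψ (x', y)) else 0 := by
        rw [sum_emb hs]
        · rw [Matrix.smul_apply, Matrix.mul_apply, smul_eq_mul, Finset.mul_sum]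
          refine Finset.sum_congr rfl fun y _ => ?_
          by_cases hy : y.1 = y.2
          · simp [hWg, hy, emb]
          · rw [if_pos ⟨y.1.2, y.2.2, fun hh => hy (Fin.castLE_injective hs hh)⟩, h1 x y hy, h1 x' y hy]
            simp only [hWg, Matrix.conjTranspose_apply, Matrix.of_apply, if_pos (show y.1 ≠ y.2 from hy),
              star_mul', star_dinv]
            push_cast
            ring
        · intro o ho
          rw [if_neg]
          tauto
      rw [Matrix.add_apply, h5]
      simp only [redDM, Matrix.of_apply, ← Finset.sum_add_distrib]
      refine Finset.sum_congr rfl fun y _ => ?_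
      split_ifs <;> simp
    rw [this]
    exact redDM_posSemidef _
  have hd2 : (0 : ℝ) < (d : ℝ) ^ 2 := by
    have : (0 : ℝ) < d := by exact_mod_cast hd
    positivity
  have := le_vNE (redDM_posSemidef ψ) ((d : ℝ) ^ 2) hd2 ht (posSemidef_self_mul_conjTranspose Wg)
    hQ1 hρQ
  rw [htr, Complex.ofReal_re] at this
  exact this

end Entropy
section Final

lemma AC_bound {s d : ℕ} (hs : s ≤ d) (hd : 0 < d) (hs0 : 0 < s)
    (US : Matrix (Fin s × Fin s) (Fin s × Fin s) ℂ) (hU : USᴴ * US = 1)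
    (hP : PerfectTensor US) :
    ((((s : ℝ) ^ 2 - s) / (d : ℝ) ^ 2) * Real.log ((d : ℝ) ^ 2)
      - (1 - ((s : ℝ) ^ 2 - s) / (d : ℝ) ^ 2)) / Real.log 2
      ≤ vNE (rhoAC (choiVec (embedU s d hs US))) := by
  have hsC : (s : ℂ) ≠ 0 := by exact_mod_cast hs0.ne'
  set W : Matrix (Fin d × Fin d) (Fin s × Fin s) ℂ := Matrix.of fun x y =>
    if hx : x.1.val < s ∧ x.2.val < s then
      US (⟨x.2.val, hx.2⟩, y.2) (⟨x.1.val, hx.1⟩, y.1) else 0 with hW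
  have hWe : ∀ x y, W (emb hs x) y = US (x.2, y.2) (x.1, y.1) := by
    intro x y; simp [hW, emb]
  have hWo : ∀ x y, ¬ (x.1.val < s ∧ x.2.val < s) → W x y = 0 := by
    intro x y hx; rw [hW, Matrix.of_apply, dif_neg hx]
  refine key_bound hs hd _ (trace_AC _ hd (embedU_unitary hs US hU)) W ?_ ?_ ?_
  · ext x x'
    by_cases hx : x.1.val < s ∧ x.2.val < s
    · by_cases hx' : x'.1.val < s ∧ x'.2.val < s
      · obtain ⟨u, rfl⟩ := exists_emb hs x hx
        obtain ⟨u', rfl⟩ := exists_emb hs x' hx'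
        simp only [Matrix.mul_apply, Matrix.conjTranspose_apply, hWe, Matrix.diagonal_apply,
          (emb_inj hs).eq_iff, if_pos hx]
        have := congrFun (congrFun hP.2.1 u) u'
        simp only [rhoAC, redDM, Matrix.of_apply, psi_mul, ← Finset.mul_sum, mmState,
          Matrix.smul_apply, Matrix.one_apply, Fintype.card_prod, Fintype.card_fin, smul_eq_mul,
          Nat.cast_mul, mul_inv] at this
        exact mul_left_cancel₀ (by simp [hsC]) this
      · have hne : x ≠ x' := by rintro rfl; exact hx' hx
        simp [Matrix.mul_apply, Matrix.diagonal_apply, hne, hWo x' _ hx']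
    · simp [Matrix.mul_apply, Matrix.diagonal_apply, hx, hWo x _ hx]
  · intro y
    rw [sum_emb hs]
    · simp only [hWe]
      have := congrFun (congrFun hP.2.2.2.2.1 y) y
      simp only [rhoBD, redDM, Matrix.of_apply, psi_mul, ← Finset.mul_sum, mmState,
          Matrix.smul_apply, Matrix.one_apply, Fintype.card_prod, Fintype.card_fin, smul_eq_mul,
          Nat.cast_mul, mul_inv, if_true] at this
      exact mul_left_cancel₀ (by simp [hsC]) this
    · intro o ho
      rw [hWo o y ho, zero_mul]
  · intro x y hy
    rw [choiVec_apply]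
    congr 1
    show embedU s d hs US (x.2, (emb hs y).2) (x.1, (emb hs y).1) = W x y
    by_cases hx : x.1.val < s ∧ x.2.val < s
    · obtain ⟨u, rfl⟩ := exists_emb hs x hx
      rw [hWe]
      exact embedU_emb hs US (u.2, y.2) (u.1, y.1)
    · rw [hWo x y hx]
      by_cases h1 : x.1.val < s
      · have h2 : ¬ x.2.val < s := fun hh => hx ⟨h1, hh⟩
        rw [embedU_out' hs US (x.2, (emb hs y).2) (x.1, (emb hs y).1) (fun hh => h2 hh.1), if_neg]
        intro hh
        have := congrArg (fun p => p.1.val) hh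
        simp only at this
        omega
      · rw [embedU_out hs US (x.2, (emb hs y).2) (x.1, (emb hs y).1) (fun hh => h1 hh.1), if_neg]
        intro hh
        have := congrArg (fun p => p.2.val) hh
        simp only [emb, Fin.val_castLE] at this
        exact hy (Fin.ext this.symm)

lemma AD_bound {s d : ℕ} (hs : s ≤ d) (hd : 0 < d) (hs0 : 0 < s)
    (US : Matrix (Fin s × Fin s) (Fin s × Fin s) ℂ) (hU : USᴴ * US = 1)
    (hP : PerfectTensor US) :
    ((((s : ℝ) ^ 2 - s) / (d : ℝ) ^ 2) * Real.log ((d : ℝ) ^ 2)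
      - (1 - ((s : ℝ) ^ 2 - s) / (d : ℝ) ^ 2)) / Real.log 2
      ≤ vNE (rhoAD (choiVec (embedU s d hs US))) := by
  have hsC : (s : ℂ) ≠ 0 := by exact_mod_cast hs0.ne'
  set W : Matrix (Fin d × Fin d) (Fin s × Fin s) ℂ := Matrix.of fun x y =>
    if hx : x.1.val < s ∧ x.2.val < s then
      US (y.2, ⟨x.2.val, hx.2⟩) (⟨x.1.val, hx.1⟩, y.1) else 0 with hW
  have hWe : ∀ x y, W (emb hs x) y = US (y.2, x.2) (x.1, y.1) := by
    intro x y; simp [hW, emb]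
  have hWo : ∀ x y, ¬ (x.1.val < s ∧ x.2.val < s) → W x y = 0 := by
    intro x y hx; rw [hW, Matrix.of_apply, dif_neg hx]
  refine key_bound hs hd _ (trace_AD _ hd (embedU_unitary hs US hU)) W ?_ ?_ ?_
  · ext x x'
    by_cases hx : x.1.val < s ∧ x.2.val < s
    · by_cases hx' : x'.1.val < s ∧ x'.2.val < s
      · obtain ⟨u, rfl⟩ := exists_emb hs x hx
        obtain ⟨u', rfl⟩ := exists_emb hs x' hx'
        simp only [Matrix.mul_apply, Matrix.conjTranspose_apply, hWe, Matrix.diagonal_apply,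
          (emb_inj hs).eq_iff, if_pos hx]
        have := congrFun (congrFun hP.2.2.1 u) u'
        simp only [rhoAD, redDM, Matrix.of_apply, psi_mul, ← Finset.mul_sum, mmState,
          Matrix.smul_apply, Matrix.one_apply, Fintype.card_prod, Fintype.card_fin, smul_eq_mul,
          Nat.cast_mul, mul_inv] at this
        exact mul_left_cancel₀ (by simp [hsC]) this
      · have hne : x ≠ x' := by rintro rfl; exact hx' hx
        simp [Matrix.mul_apply, Matrix.diagonal_apply, hne, hWo x' _ hx']
    · simp [Matrix.mul_apply, Matrix.diagonal_apply, hx, hWo x _ hx]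
  · intro y
    rw [sum_emb hs]
    · simp only [hWe]
      have := congrFun (congrFun hP.2.2.2.1 y) y
      simp only [rhoBC, redDM, Matrix.of_apply, psi_mul, ← Finset.mul_sum, mmState,
          Matrix.smul_apply, Matrix.one_apply, Fintype.card_prod, Fintype.card_fin, smul_eq_mul,
          Nat.cast_mul, mul_inv, if_true] at this
      exact mul_left_cancel₀ (by simp [hsC]) this
    · intro o ho
      rw [hWo o y ho, zero_mul]
  · intro x y hy
    rw [choiVec_apply]
    congr 1
    show embedU s d hs US ((emb hs y).2, x.2) (x.1, (emb hs y).1) = W x y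
    by_cases hx : x.1.val < s ∧ x.2.val < s
    · obtain ⟨u, rfl⟩ := exists_emb hs x hx
      rw [hWe]
      exact embedU_emb hs US (y.2, u.2) (u.1, y.1)
    · rw [hWo x y hx]
      by_cases h1 : x.1.val < s
      · have h2 : ¬ x.2.val < s := fun hh => hx ⟨h1, hh⟩
        rw [embedU_out' hs US ((emb hs y).2, x.2) (x.1, (emb hs y).1) (fun hh => h2 hh.2), if_neg]
        intro hh
        have := congrArg (fun p => p.2.val) hh
        simp only [emb, Fin.val_castLE] at this
        have := y.1.2
        omega
      · rw [embedU_out hs US ((emb hs y).2, x.2) (x.1, (emb hs y).1) (fun hh => h1 hh.1), if_neg]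
        intro hh
        have := congrArg (fun p => p.1.val) hh
        simp only [emb, Fin.val_castLE] at this
        have := y.2.2
        omega

lemma I3_upper {s d d₀ : ℕ} (hs : s ≤ d) (hd : s + d₀ = d) (hs0 : 0 < s)
    (US : Matrix (Fin s × Fin s) (Fin s × Fin s) ℂ) (hU : USᴴ * US = 1)
    (hP : PerfectTensor US) :
    0 ≤ I3ACD (choiVec (embedU s d hs US)) + 2 * Real.logb 2 d ∧
    I3ACD (choiVec (embedU s d hs US)) + 2 * Real.logb 2 d ≤
      2 * (2 * d₀ + 1) * ((2 * (Real.log d / d) + 1 / d) / Real.log 2) := by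
  have hdp : 0 < d := by omega
  have hdR : (0 : ℝ) < d := by exact_mod_cast hdp
  have hl2 : 0 < Real.log 2 := Real.log_pos (by norm_num)
  have hUU := embedU_unitary hs US hU
  have hlog : Real.logb 2 ((d : ℝ) ^ 2) = 2 * Real.logb 2 d := by
    rw [Real.logb_pow]; simp
  have hcard : ((Fintype.card (Fin d × Fin d) : ℕ) : ℝ) = (d : ℝ) ^ 2 := by
    simp [sq]
  rw [I3_eq _ hdp hUU]
  constructor
  · have h1 : vNE (rhoAC (choiVec (embedU s d hs US))) ≤ _ := vNE_le (redDM_posSemidef _) ((d : ℝ) ^ 2) (by positivity) hcard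
      (trace_AC _ hdp hUU)
    have h2 : vNE (rhoAD (choiVec (embedU s d hs US))) ≤ _ := vNE_le (redDM_posSemidef _) ((d : ℝ) ^ 2) (by positivity) hcard
      (trace_AD _ hdp hUU)
    rw [hlog] at h1 h2
    linarith
  · have h1 := AC_bound hs hdp hs0 US hU hP
    have h2 := AD_bound hs hdp hs0 US hU hP
    set r : ℝ := ((s : ℝ) ^ 2 - s) / (d : ℝ) ^ 2 with hr
    have hr1 : 1 - r ≤ (2 * d₀ + 1) / d := by
      have e : (s : ℝ) = d - d₀ := by rw [← hd]; push_cast; ring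
      have e0 : (0 : ℝ) ≤ d₀ := by positivity
      rw [hr, e, sub_le_iff_le_add, div_add_div _ _ hdR.ne' (by positivity), le_div_iff₀ (by positivity)]
      have : 0 ≤ (d : ℝ) * ((d₀ : ℝ) ^ 2 + d₀) := by positivity
      nlinarith
    have hlogd : 0 ≤ Real.log d := Real.log_natCast_nonneg d
    have h3 : 2 * Real.logb 2 d - (r * Real.log ((d : ℝ) ^ 2) - (1 - r)) / Real.log 2 ≤
        (2 * d₀ + 1) * ((2 * (Real.log d / d) + 1 / d) / Real.log 2) := by
      have : 2 * Real.logb 2 d - (r * Real.log ((d : ℝ) ^ 2) - (1 - r)) / Real.log 2 =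
          ((1 - r) * (2 * Real.log d + 1)) / Real.log 2 := by
        rw [Real.logb, Real.log_pow]; push_cast; field_simp; ring
      rw [this]
      have h4 : (2 * d₀ + 1) * ((2 * (Real.log d / d) + 1 / d) / Real.log 2) =
         ((2 * d₀ + 1) / d * (2 * Real.log d + 1)) / Real.log 2 := by
        field_simp
      rw [h4]
      gcongr
    linarith

lemma tendsto_aux (d₀ : ℕ) : Filter.Tendsto (fun d : ℕ =>
    2 * (2 * (d₀ : ℝ) + 1) * ((2 * (Real.log d / d) + 1 / d) / Real.log 2)) atTop (nhds 0) := by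
  have h1 : Filter.Tendsto (fun d : ℕ => Real.log d / d) atTop (nhds 0) :=
    (Real.isLittleO_log_id_atTop.tendsto_div_nhds_zero).comp tendsto_natCast_atTop_atTop
  have h2 : Filter.Tendsto (fun d : ℕ => 1 / (d : ℝ)) atTop (nhds 0) :=
    tendsto_one_div_atTop_nhds_zero_nat
  have := (((h1.const_mul 2).add h2).div_const (Real.log 2)).const_mul (2 * (2 * (d₀ : ℝ) + 1))
  simpa using this

end Final

/-- For a fixed constant `d₀` and `d_S = d - d₀` odd: (i) the tripartite
information of `U_d` tends to its maximally negative value `-2 log₂ d`; (ii) the residual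
channels stay at diamond distance tending to `2` from the completely depolarizing channel;
(iii) the residual channel acts as the identity on the `d₀`-dimensional subspace spanned by
`{|a⟩ : a ≥ d_S}`, and hence a `d₀`-dimensional system can be sent through it with zero
error, i.e., its one-shot zero-error quantum capacity is at least `log₂ d₀ > 0`. -/
theorem nonrobustness_of_maximal_scrambling (d₀ : ℕ) (hd₀ : 2 ≤ d₀)
    (US : ∀ d : ℕ, Matrix (Fin (d - d₀) × Fin (d - d₀)) (Fin (d - d₀) × Fin (d - d₀)) ℂ)
    (hUS : ∀ d : ℕ, Odd (d - d₀) → IsUnitaryMat (US d) ∧ PerfectTensor (US d)) :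
    Filter.Tendsto
      (fun d : ℕ =>
        I3ACD (choiVec (embedU (d - d₀) d (Nat.sub_le d d₀) (US d))) + 2 * Real.logb 2 d)
      (Filter.atTop ⊓ Filter.principal {d : ℕ | Odd (d - d₀)}) (nhds 0) ∧
    Filter.Tendsto
      (fun d : ℕ =>
        diamondDist (residual (embedU (d - d₀) d (Nat.sub_le d d₀) (US d)))
          (depol (Fin d) (Fin d)))
      (Filter.atTop ⊓ Filter.principal {d : ℕ | Odd (d - d₀)}) (nhds 2) ∧
    ∀ d : ℕ, Odd (d - d₀) →
      (∀ σ : Matrix (Fin d) (Fin d) ℂ,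
        (∀ x y : Fin d, (x.val < d - d₀ ∨ y.val < d - d₀) → σ x y = 0) →
        residual (embedU (d - d₀) d (Nat.sub_le d d₀) (US d)) σ = σ) ∧
      0 < Real.logb 2 d₀ ∧
      ∃ V : Matrix (Fin d) (Fin d₀) ℂ, Vᴴ * V = 1 ∧
        ∃ (k : ℕ) (K : Fin k → Matrix (Fin d₀) (Fin d) ℂ),
          (∑ i, (K i)ᴴ * K i) = 1 ∧
          ∀ σ : Matrix (Fin d₀) (Fin d₀) ℂ,
            (∑ i, K i * residual (embedU (d - d₀) d (Nat.sub_le d d₀) (US d))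
              (V * σ * Vᴴ) * (K i)ᴴ) = σ := by
  have hodd : ∀ᶠ d : ℕ in (Filter.atTop ⊓ Filter.principal {d : ℕ | Odd (d - d₀)}),
      Odd (d - d₀) :=
    (Filter.eventually_principal.2 fun _ hx => hx).filter_mono inf_le_right
  have hpos : ∀ d : ℕ, Odd (d - d₀) → 0 < d - d₀ ∧ d - d₀ + d₀ = d ∧ d - d₀ < d := by
    intro d hd
    have := hd.pos
    omega
  refine ⟨?_, ?_, ?_⟩
  · refine tendsto_of_tendsto_of_tendsto_of_le_of_le' tendsto_const_nhds
      ((tendsto_aux d₀).mono_left inf_le_left) ?_ ?_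
    · filter_upwards [hodd] with d hd
      obtain ⟨h1, h2, h3⟩ := hpos d hd
      exact (I3_upper (Nat.sub_le d d₀) h2 h1 (US d) (hUS d hd).1.2 (hUS d hd).2).1
    · filter_upwards [hodd] with d hd
      obtain ⟨h1, h2, h3⟩ := hpos d hd
      exact (I3_upper (Nat.sub_le d d₀) h2 h1 (US d) (hUS d hd).1.2 (hUS d hd).2).2
  · have h0 : Filter.Tendsto (fun d : ℕ => 2 - 2 / (d : ℝ)) atTop (nhds 2) := by
      have := (tendsto_const_div_atTop_nhds_zero_nat (2 : ℝ)).const_sub 2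
      simpa using this
    refine tendsto_of_tendsto_of_tendsto_of_le_of_le' (h0.mono_left inf_le_left)
      tendsto_const_nhds ?_ ?_
    · filter_upwards [hodd] with d hd
      obtain ⟨h1, h2, h3⟩ := hpos d hd
      exact le_diamond (Nat.sub_le d d₀) (US d) h3 (hUS d hd).1.2
    · filter_upwards [hodd] with d hd
      obtain ⟨h1, h2, h3⟩ := hpos d hd
      exact diamond_le_two (Nat.sub_le d d₀) (US d) (by omega) (hUS d hd).1.2
  · intro d hd
    obtain ⟨h1, h2, h3⟩ := hpos d hd
    refine ⟨fun σ hσ => residual_id (Nat.sub_le d d₀) (US d) σ hσ, ?_,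
      decoder (Nat.sub_le d d₀) (US d) d₀ (by omega) h2⟩
    exact Real.logb_pos (by norm_num) (by exact_mod_cast hd₀)

end Scrambling

end
end

section
/- Let d_S ≤ d with d_S odd and d₀ = d − d_S, and let U_d be the bipartite unitary on ℂ^d⊗ℂ^d defined by U_d|a⟩|b⟩ = U_S|a⟩|b⟩ if a,b < d_S and U_d|a⟩|b⟩ = |a⟩|b⟩ otherwise, with Choi state ρ. Then the Rényi-2 tripartite information satisfies I₃^{(2)}(A;C;D)_{U_d} = −S₂(ρ_{AC}) = log₂ tr(ρ_{AC}²), with tr(ρ_{AC}²) ≥ d₀² d_S²/d⁴, so that I₃^{(2)}(A;C;D)_{U_d} ≥ −2 log₂ d + 2 log₂(1 − d₀/d) + 2 log₂ d₀. -/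
open Matrix Kronecker Filter
open scoped BigOperators Classical ComplexOrder

noncomputable section

namespace Scrambling

lemma choi_norm (n : ℕ) (x y : ℂ) :
    ((Real.sqrt ((Fintype.card (Fin n) : ℝ) * Fintype.card (Fin n)) : ℂ)⁻¹ * x) *
      star ((Real.sqrt ((Fintype.card (Fin n) : ℝ) * Fintype.card (Fin n)) : ℂ)⁻¹ * y)
      = ((n : ℂ) * n)⁻¹ * (x * star y) := by
  have h1 : Real.sqrt ((n : ℝ) * n) = n := Real.sqrt_mul_self (Nat.cast_nonneg n)
  simp only [Fintype.card_fin, h1]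
  simp
  ring

lemma rhoAD_apply {n : ℕ} (U : Matrix (Fin n × Fin n) (Fin n × Fin n) ℂ) (a e a' e' : Fin n) :
    rhoAD (choiVec U) (a, e) (a', e') =
      ((n : ℂ) * n)⁻¹ * ∑ b, ∑ c, U (c, e) (a, b) * star (U (c, e') (a', b)) := by
  simp only [rhoAD, redDM, choiVec, Matrix.of_apply, Fintype.sum_prod_type, choi_norm,
    Finset.mul_sum]

lemma rhoBC_apply {n : ℕ} (U : Matrix (Fin n × Fin n) (Fin n × Fin n) ℂ) (b c b' c' : Fin n) :
    rhoBC (choiVec U) (b, c) (b', c') =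
      ((n : ℂ) * n)⁻¹ * ∑ a, ∑ e, U (c, e) (a, b) * star (U (c', e) (a, b')) := by
  simp only [rhoBC, redDM, choiVec, Matrix.of_apply, Fintype.sum_prod_type, choi_norm,
    Finset.mul_sum]

lemma rhoAC_apply {n : ℕ} (U : Matrix (Fin n × Fin n) (Fin n × Fin n) ℂ) (a c a' c' : Fin n) :
    rhoAC (choiVec U) (a, c) (a', c') =
      ((n : ℂ) * n)⁻¹ * ∑ b, ∑ e, U (c, e) (a, b) * star (U (c', e) (a', b)) := by
  simp only [rhoAC, redDM, choiVec, Matrix.of_apply, Fintype.sum_prod_type, choi_norm,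
    Finset.mul_sum]

lemma mm_apply (n : ℕ) (a e a' e' : Fin n) :
    mmState (Fin n × Fin n) (a, e) (a', e') =
      ((n : ℂ) * n)⁻¹ * if a = a' ∧ e = e' then 1 else 0 := by
  simp [mmState, Matrix.one_apply]

section emb
variable {m k : ℕ} (h : m ≤ m + k) (US : Matrix (Fin m × Fin m) (Fin m × Fin m) ℂ)

lemma emb1 (a b c e : Fin m) : embedU m (m+k) h US (Fin.castAdd k c, Fin.castAdd k e)
    (Fin.castAdd k a, Fin.castAdd k b) = US (c, e) (a, b) := by
  simp [embedU]

lemma emb2 (a b : Fin m) (c : Fin k) (e : Fin (m+k)) :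
    embedU m (m+k) h US (Fin.natAdd m c, e) (Fin.castAdd k a, Fin.castAdd k b) = 0 := by
  simp [embedU]

lemma emb3 (a b : Fin m) (e : Fin k) (c : Fin (m+k)) :
    embedU m (m+k) h US (c, Fin.natAdd m e) (Fin.castAdd k a, Fin.castAdd k b) = 0 := by
  simp [embedU]

lemma emb4 (a : Fin k) (b : Fin (m+k)) (c e : Fin (m+k)) :
    embedU m (m+k) h US (c, e) (Fin.natAdd m a, b) =
      if c = Fin.natAdd m a ∧ e = b then 1 else 0 := by
  simp [embedU]

lemma emb5 (b : Fin k) (a : Fin (m+k)) (c e : Fin (m+k)) :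
    embedU m (m+k) h US (c, e) (a, Fin.natAdd m b) =
      if c = a ∧ e = Fin.natAdd m b then 1 else 0 := by
  simp [embedU]

lemma cn (a : Fin m) (b : Fin k) : Fin.castAdd k a ≠ Fin.natAdd m b := by
  intro hh
  have := congrArg Fin.val hh
  simp at this
  omega

lemma nc (a : Fin m) (b : Fin k) : Fin.natAdd m b ≠ Fin.castAdd k a := (cn a b).symm

lemma nn (a b : Fin k) : Fin.natAdd m a = Fin.natAdd m b ↔ a = b := by
  constructor
  · intro hh
    have := congrArg Fin.val hh
    simp at this
    omega
  · rintro rfl; rfl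

lemma embAD (hU : ∀ a e a' e', ∑ b, ∑ c, US (c, e) (a, b) * star (US (c, e') (a', b)) =
      if a = a' ∧ e = e' then 1 else 0) (a e a' e' : Fin (m+k)) :
    ∑ b, ∑ c, embedU m (m+k) h US (c, e) (a, b) * star (embedU m (m+k) h US (c, e') (a', b)) =
      if a = a' ∧ e = e' then 1 else 0 := by
  simp only [Complex.star_def] at hU ⊢
  induction a using Fin.addCases <;> induction a' using Fin.addCases <;>
  induction e using Fin.addCases <;> induction e' using Fin.addCases <;>
  simp [Fin.sum_univ_add, emb1, emb2, emb3, emb4, emb5, nn, cn, nc, hU, ite_and, apply_ite,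
    Finset.sum_ite_eq, eq_comm] <;> (split_ifs <;> simp_all)

lemma embBC (hU : ∀ b c b' c', ∑ a, ∑ e, US (c, e) (a, b) * star (US (c', e) (a, b')) =
      if b = b' ∧ c = c' then 1 else 0) (b c b' c' : Fin (m+k)) :
    ∑ a, ∑ e, embedU m (m+k) h US (c, e) (a, b) * star (embedU m (m+k) h US (c', e) (a, b')) =
      if b = b' ∧ c = c' then 1 else 0 := by
  simp only [Complex.star_def] at hU ⊢
  induction b using Fin.addCases <;> induction b' using Fin.addCases <;>
  induction c using Fin.addCases <;> induction c' using Fin.addCases <;>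
  simp [Fin.sum_univ_add, emb1, emb2, emb3, emb4, emb5, nn, cn, nc, hU, ite_and, apply_ite,
    Finset.sum_ite_eq, eq_comm] <;> (split_ifs <;> simp_all)

lemma embAC (hU : ∀ a c a' c', ∑ b, ∑ e, US (c, e) (a, b) * star (US (c', e) (a', b)) =
      if a = a' ∧ c = c' then 1 else 0) (a a' : Fin m) :
    ∑ b, ∑ e, embedU m (m+k) h US (Fin.castAdd k a, e) (Fin.castAdd k a, b) *
      star (embedU m (m+k) h US (Fin.castAdd k a', e) (Fin.castAdd k a', b)) =
      (k : ℂ) + if a = a' then 1 else 0 := by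
  simp only [Complex.star_def] at hU ⊢
  simp [Fin.sum_univ_add, emb1, emb2, emb3, emb4, emb5, nn, cn, nc, hU, ite_and, apply_ite,
    Finset.sum_ite_eq]
  intro hh
  rw [if_pos hh, add_comm]

end emb

lemma trace_sq {X Y : Type*} [Fintype X] [Fintype Y] (ψ : X × Y → ℂ) :
    ((redDM ψ * redDM ψ).trace).re = ∑ x, ∑ x', Complex.normSq (redDM ψ x x') := by
  simp only [Matrix.trace, Matrix.diag, Matrix.mul_apply, Complex.re_sum]
  refine Finset.sum_congr rfl fun x _ => Finset.sum_congr rfl fun x' _ => ?_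
  have : redDM ψ x' x = star (redDM ψ x x') := by
    simp [redDM, mul_comm]
  rw [this, Complex.star_def, Complex.mul_conj]
  simp

lemma S2_mm (X : Type*) [Fintype X] [DecidableEq X] [Nonempty X] :
    S2 (mmState X) = Real.logb 2 (Fintype.card X) := by
  have hX : (Fintype.card X : ℂ) ≠ 0 := by simp
  have : (mmState X * mmState X).trace = (((Fintype.card X : ℝ)⁻¹ : ℝ) : ℂ) := by
    simp [mmState, Matrix.trace_smul, hX]
  rw [S2, this, Complex.ofReal_re, Real.logb_inv, neg_neg]

lemma rhoA_of_AD {n : ℕ} (hn : n ≠ 0) (ψ : (Fin n × Fin n) × Fin n × Fin n → ℂ)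
    (hh : rhoAD ψ = mmState _) : rhoA ψ = mmState _ := by
  ext a a'
  have : rhoA ψ a a' = ∑ e, rhoAD ψ (a, e) (a', e) := by
    simp only [rhoA, rhoAD, redDM, Matrix.of_apply, Fintype.sum_prod_type]
    rw [Finset.sum_comm (s := Finset.univ (α := Fin n)) (γ := Fin n)
      (f := fun e b => ∑ c, ψ ((a, b), (c, e)) * star (ψ ((a', b), (c, e))))]
    exact Finset.sum_congr rfl fun b _ => Finset.sum_comm
  rw [this, hh]
  have hn' : (n : ℂ) ≠ 0 := by exact_mod_cast hn
  simp [mm_apply, mmState, Matrix.one_apply]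
  split_ifs <;> field_simp

lemma rhoB_of_BC {n : ℕ} (hn : n ≠ 0) (ψ : (Fin n × Fin n) × Fin n × Fin n → ℂ)
    (hh : rhoBC ψ = mmState _) : rhoB ψ = mmState _ := by
  ext a a'
  have : rhoB ψ a a' = ∑ e, rhoBC ψ (a, e) (a', e) := by
    simp only [rhoB, rhoBC, redDM, Matrix.of_apply, Fintype.sum_prod_type]
    rw [Finset.sum_comm]
  rw [this, hh]
  have hn' : (n : ℂ) ≠ 0 := by exact_mod_cast hn
  simp [mm_apply, mmState, Matrix.one_apply]
  split_ifs <;> field_simp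

/-- For `U_d` with `d_S ≤ d` odd and `d₀ = d - d_S`, the Rényi-2
tripartite information satisfies `I₃⁽²⁾ = -S₂(ρ_{AC}) = log₂ tr ρ_{AC}²`, with
`tr ρ_{AC}² ≥ d₀² d_S² / d⁴`, so that
`I₃⁽²⁾ ≥ -2 log₂ d + 2 log₂(1 - d₀/d) + 2 log₂ d₀`. -/
theorem renyi_two_tripartite_bound (dS d : ℕ) (h : dS ≤ d) (hodd : Odd dS)
    (US : Matrix (Fin dS × Fin dS) (Fin dS × Fin dS) ℂ)
    (hUSu : IsUnitaryMat US) (hUSp : PerfectTensor US) :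
    I3r2 (choiVec (embedU dS d h US)) = -S2 (rhoAC (choiVec (embedU dS d h US))) ∧
    -S2 (rhoAC (choiVec (embedU dS d h US))) =
      Real.logb 2 (((rhoAC (choiVec (embedU dS d h US)) *
        rhoAC (choiVec (embedU dS d h US))).trace).re) ∧
    ((d - dS : ℕ) : ℝ) ^ 2 * (dS : ℝ) ^ 2 / (d : ℝ) ^ 4 ≤
      ((rhoAC (choiVec (embedU dS d h US)) *
        rhoAC (choiVec (embedU dS d h US))).trace).re ∧
    -2 * Real.logb 2 d + 2 * Real.logb 2 (1 - ((d - dS : ℕ) : ℝ) / d)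
        + 2 * Real.logb 2 ((d - dS : ℕ) : ℝ) ≤
      I3r2 (choiVec (embedU dS d h US)) := by
  have hS : dS ≠ 0 := by rintro rfl; simp at hodd
  obtain ⟨k, rfl⟩ := Nat.exists_eq_add_of_le h
  have hS' : (dS : ℂ) ≠ 0 := by exact_mod_cast hS
  have hSS : ((dS : ℂ) * dS)⁻¹ ≠ 0 := by simp [hS']
  have hd : dS + k ≠ 0 := by omega
  have : Nonempty (Fin (dS + k)) := ⟨⟨0, by omega⟩⟩
  obtain ⟨-, pAC, pAD, pBC, -, -⟩ := hUSp
  have qAC : ∀ a c a' c', ∑ b, ∑ e, US (c, e) (a, b) * star (US (c', e) (a', b)) =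
      if a = a' ∧ c = c' then 1 else 0 := fun a c a' c' => by
    have := congrFun (congrFun pAC (a, c)) (a', c')
    rw [rhoAC_apply, mm_apply] at this
    exact mul_left_cancel₀ hSS this
  have qAD : ∀ a e a' e', ∑ b, ∑ c, US (c, e) (a, b) * star (US (c, e') (a', b)) =
      if a = a' ∧ e = e' then 1 else 0 := fun a c a' c' => by
    have := congrFun (congrFun pAD (a, c)) (a', c')
    rw [rhoAD_apply, mm_apply] at this
    exact mul_left_cancel₀ hSS this
  have qBC : ∀ b c b' c', ∑ a, ∑ e, US (c, e) (a, b) * star (US (c', e) (a, b')) =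
      if b = b' ∧ c = c' then 1 else 0 := fun a c a' c' => by
    have := congrFun (congrFun pBC (a, c)) (a', c')
    rw [rhoBC_apply, mm_apply] at this
    exact mul_left_cancel₀ hSS this
  have rAD : rhoAD (choiVec (embedU dS (dS + k) h US)) = mmState _ := by
    ext ⟨a, e⟩ ⟨a', e'⟩
    rw [rhoAD_apply, mm_apply, embAD h US qAD]
  have rBC : rhoBC (choiVec (embedU dS (dS + k) h US)) = mmState _ := by
    ext ⟨a, e⟩ ⟨a', e'⟩
    rw [rhoBC_apply, mm_apply, embBC h US qBC]
  have rA := rhoA_of_AD hd _ rAD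
  have rB := rhoB_of_BC hd _ rBC
  have hdR : (0 : ℝ) < ((dS + k : ℕ) : ℝ) := by exact_mod_cast Nat.pos_of_ne_zero hd
  have hSR : (0 : ℝ) < (dS : ℝ) := by exact_mod_cast Nat.pos_of_ne_zero hS
  have e1 : I3r2 (choiVec (embedU dS (dS + k) h US)) =
      -S2 (rhoAC (choiVec (embedU dS (dS + k) h US))) := by
    rw [I3r2, rA, rB, rAD, S2_mm, S2_mm, Fintype.card_prod, Fintype.card_fin, Nat.cast_mul,
      Real.logb_mul hdR.ne' hdR.ne']
    ring
  have e3 : (((dS + k) - dS : ℕ) : ℝ) ^ 2 * (dS : ℝ) ^ 2 / ((dS + k : ℕ) : ℝ) ^ 4 ≤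
      ((rhoAC (choiVec (embedU dS (dS + k) h US)) *
        rhoAC (choiVec (embedU dS (dS + k) h US))).trace).re := by
    have ht : ((rhoAC (choiVec (embedU dS (dS + k) h US)) *
        rhoAC (choiVec (embedU dS (dS + k) h US))).trace).re = _ := trace_sq _
    change _ = ∑ x, ∑ x', Complex.normSq (rhoAC (choiVec (embedU dS (dS + k) h US)) x x') at ht
    rw [ht]
    let f : Fin dS ↪ Fin (dS + k) × Fin (dS + k) :=
      ⟨fun a => (Fin.castAdd k a, Fin.castAdd k a), fun a b hab => by simpa using hab⟩
    have key : ∀ a a' : Fin dS, (k : ℝ) ^ 2 / ((dS + k : ℕ) : ℝ) ^ 4 ≤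
        Complex.normSq (rhoAC (choiVec (embedU dS (dS + k) h US)) (f a) (f a')) := by
      intro a a'
      change _ ≤ Complex.normSq (rhoAC (choiVec (embedU dS (dS + k) h US))
        (Fin.castAdd k a, Fin.castAdd k a) (Fin.castAdd k a', Fin.castAdd k a'))
      rw [rhoAC_apply, embAC h US qAC]
      have : (((dS + k : ℕ) : ℂ) * ((dS + k : ℕ) : ℂ))⁻¹ * ((k : ℂ) + if a = a' then 1 else 0)
        = ((((((dS + k : ℕ) : ℝ) * ((dS + k : ℕ) : ℝ))⁻¹ *
            ((k : ℝ) + if a = a' then 1 else 0) : ℝ)) : ℂ) := by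
        split_ifs <;> push_cast <;> ring
      rw [this, Complex.normSq_ofReal]
      have h0 : (0 : ℝ) ≤ if a = a' then 1 else 0 := by split_ifs <;> norm_num
      have hk : (0 : ℝ) ≤ k := Nat.cast_nonneg k
      rw [show ∀ D x : ℝ, (D * D)⁻¹ * x * ((D * D)⁻¹ * x) = x ^ 2 / D ^ 4 by
        intro D x; rw [mul_inv, div_eq_mul_inv, ← inv_pow]; ring]
      gcongr
      linarith
    calc _ = ∑ a : Fin dS, ∑ a' : Fin dS, (k : ℝ) ^ 2 / ((dS + k : ℕ) : ℝ) ^ 4 := by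
          simp; ring
      _ ≤ ∑ a : Fin dS, ∑ a' : Fin dS,
          Complex.normSq (rhoAC (choiVec (embedU dS (dS + k) h US)) (f a) (f a')) :=
        Finset.sum_le_sum fun a _ => Finset.sum_le_sum fun a' _ => key a a'
      _ ≤ ∑ a : Fin dS, ∑ x',
          Complex.normSq (rhoAC (choiVec (embedU dS (dS + k) h US)) (f a) x') := by
        refine Finset.sum_le_sum fun a _ => ?_
        rw [← Finset.sum_map Finset.univ f
          (fun x' => Complex.normSq (rhoAC (choiVec (embedU dS (dS + k) h US)) (f a) x'))]
        exact Finset.sum_le_sum_of_subset_of_nonneg (Finset.subset_univ _)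
          fun _ _ _ => Complex.normSq_nonneg _
      _ ≤ _ := by
        rw [← Finset.sum_map Finset.univ f
          (fun x => ∑ x', Complex.normSq (rhoAC (choiVec (embedU dS (dS + k) h US)) x x'))]
        exact Finset.sum_le_sum_of_subset_of_nonneg (Finset.subset_univ _)
          fun _ _ _ => Finset.sum_nonneg fun _ _ => Complex.normSq_nonneg _
  have e2 : -S2 (rhoAC (choiVec (embedU dS (dS + k) h US))) =
      Real.logb 2 (((rhoAC (choiVec (embedU dS (dS + k) h US)) *
        rhoAC (choiVec (embedU dS (dS + k) h US))).trace).re) := by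
    rw [S2, neg_neg]
  refine ⟨e1, e2, e3, ?_⟩
  rcases Nat.eq_zero_or_pos k with rfl | hk
  · have : embedU dS (dS + 0) h US = US := by
      ext ⟨c, e⟩ ⟨a, b⟩
      have := c.2
      have := e.2
      have := a.2
      have := b.2
      simp [embedU]
    rw [e1, this]
    change _ ≤ -S2 (rhoAC (choiVec US))
    have : Nonempty (Fin dS) := ⟨⟨0, by omega⟩⟩
    rw [pAC, S2_mm, Fintype.card_prod, Fintype.card_fin, Nat.cast_mul,
      Real.logb_mul hSR.ne' hSR.ne']
    simp
    linarith
  · have hkR : (0 : ℝ) < k := by exact_mod_cast hk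
    rw [e1, e2]
    refine le_trans (le_of_eq ?_) (Real.logb_le_logb_of_le (by norm_num) ?_ e3)
    · have h1 : 1 - (((dS + k) - dS : ℕ) : ℝ) / ((dS + k : ℕ) : ℝ) =
          (dS : ℝ) / ((dS + k : ℕ) : ℝ) := by
        rw [Nat.add_sub_cancel_left]
        field_simp
        push_cast; ring
      rw [h1, Nat.add_sub_cancel_left, Real.logb_div hSR.ne' hdR.ne',
        Real.logb_div (by positivity) (by positivity),
        Real.logb_mul (by positivity) (by positivity),
        Real.logb_pow, Real.logb_pow, Real.logb_pow]
      push_cast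
      ring
    · rw [Nat.add_sub_cancel_left]
      positivity

end Scrambling

end
end
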